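/- arXiv:1003.5060 — 3 statements merged into one kernel-verified Lean document; each statement's English description precedes it below -/
import Mathlib

section
/- Let p be a prime number and G = ℤ/pℤ × ℤ/pℤ. Then θ(k, G) = p(p - k + 1) for 1 ≤ k ≤ p, and θ(k, G) = p - ⌊k/p⌋ + 1 for p ≤ k ≤ p². -/
open Function

/-- The Fourier transform of `f : G → ℂ` on a finite abelian group `G`, as a function on the
dual group of characters: `f̂(χ) = ∑ x, f x * χ(-x)`. -/
noncomputable def dft (G : Type*) [AddCommGroup G] [Fintype G] (f : G → ℂ) :
    AddChar G ℂ → ℂ :=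
  fun χ => ∑ x : G, f x * χ (-x)

/-- Meshulam's function `θ(k, G)`: the minimal size of the spectrum of a nonzero function
on `G` whose support has size at most `k`. -/
noncomputable def theta (G : Type*) [AddCommGroup G] [Fintype G] (k : ℕ) : ℕ :=
  sInf {l | ∃ f : G → ℂ, f ≠ 0 ∧ (support f).ncard ≤ k ∧ (support (dft G f)).ncard = l}

section Polynomial

open Polynomial

/-- Over a domain of characteristic `p`, a nonzero polynomial with all exponents below `p` that
vanishes at `1` to order `m` has more than `m` nonzero coefficients. -/
lemma card_support_gt_of_X_sub_one_pow_dvd {K : Type*} [CommRing K] [IsDomain K] (p : ℕ)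
    [CharP K p] (m : ℕ) (P : K[X]) (hP : P ≠ 0) (hlt : ∀ i ∈ P.support, i < p)
    (hdvd : (X - 1) ^ m ∣ P) : m < P.support.card := by
  induction m generalizing P with
  | zero => exact Finset.card_pos.mpr (support_nonempty.mpr hP)
  | succ m ih =>
    obtain ⟨n, hn⟩ := support_nonempty.mpr hP
    set Q : K[X] := X * derivative P - C (n : K) * P with hQ
    have hcoeff (i : ℕ) : Q.coeff i = ((i : K) - n) * P.coeff i := by
      cases i with
      | zero => simp [hQ]
      | succ i =>
        simp only [hQ, coeff_sub, coeff_X_mul, coeff_derivative, coeff_C_mul]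
        push_cast
        ring
    have hsupp : Q.support = P.support.erase n := by
      ext i
      simp only [mem_support_iff, hcoeff, Finset.mem_erase, mul_ne_zero_iff]
      refine and_congr_left fun hi => ?_
      rw [sub_ne_zero, not_iff_not]
      refine ⟨fun h => ?_, fun h => by rw [h]⟩
      have h2 := (CharP.natCast_eq_natCast K p).mp h
      exact Nat.ModEq.eq_of_lt_of_lt h2 (hlt i (mem_support_iff.mpr hi)) (hlt n hn)
    have hQdvd : (X - 1) ^ m ∣ Q := by
      obtain ⟨R, hR⟩ := hdvd
      refine dvd_sub (Dvd.dvd.mul_left ?_ _)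
        (Dvd.dvd.mul_left (hR ▸ Dvd.dvd.mul_right (pow_dvd_pow _ m.le_succ) _) _)
      refine ⟨((m : K[X]) + 1) * R + (X - 1) * derivative R, ?_⟩
      rw [hR, derivative_mul, derivative_pow]
      simp
      ring
    have hcard : Q.support.card + 1 = P.support.card := by
      rw [hsupp, Finset.card_erase_add_one hn]
    have hQ0 : Q ≠ 0 := by
      intro h0
      have hone : P.support.card = 1 := by rw [← hcard, h0]; simp
      obtain ⟨k, x, hx, rfl⟩ := card_support_eq_one.mp hone
      have h1 : (X - 1 : K[X]) ∣ C x * X ^ k := (dvd_pow_self _ m.succ_ne_zero).trans hdvd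
      rw [← C_1, dvd_iff_isRoot] at h1
      simp [IsRoot, hx] at h1
    have := ih Q hQ0 (fun i hi => hlt i (Finset.mem_of_mem_erase (hsupp ▸ hi))) hQdvd
    omega

/-- There is a valuation subring of `ℂ` whose residue field has characteristic `p`. -/
lemma exists_valuationSubring_charP_residueField (p : ℕ) [hp : Fact p.Prime] :
    ∃ V : ValuationSubring ℂ, CharP (IsLocalRing.ResidueField V) p := by
  let A : Subring ℂ := (Int.castRingHom ℂ).range
  have hI : Ideal.span {(p : A)} ≠ ⊤ := by
    rw [Ne, Ideal.span_singleton_eq_top]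
    intro hu
    obtain ⟨⟨_, n, rfl⟩, hb⟩ := hu.exists_right_inv
    have h1 : (p : ℂ) * (n : ℂ) = 1 := by simpa using congrArg Subtype.val hb
    have h2 : (p : ℤ) * n = 1 := by exact_mod_cast h1
    have h3 := Int.isUnit_iff.mp (IsUnit.of_mul_eq_one _ h2)
    have := hp.out.two_le
    omega
  obtain ⟨V, -, hV⟩ := Ideal.image_subset_nonunits_valuationSubring _ hI
  refine ⟨V, ?_⟩
  have hmem : ((p : V) : ℂ) ∈ V.nonunits :=
    hV ⟨(p : A), Ideal.mem_span_singleton_self _, by simp⟩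
  have hmax : (p : V) ∈ IsLocalRing.maximalIdeal V := by
    rw [ValuationSubring.valuation_lt_one_iff]
    exact hmem
  have h0 : ((p : ℕ) : IsLocalRing.ResidueField V) = 0 := by
    rw [← map_natCast (IsLocalRing.residue V), IsLocalRing.residue_eq_zero_iff]
    exact hmax
  exact (CharP.charP_iff_prime_eq_zero hp.out).mpr h0

/-- A nonzero complex polynomial of degree less than `p` that vanishes at `m` distinct `p`-th roots
of unity has more than `m` nonzero coefficients. -/
lemma card_lt_card_support_of_isRoot_of_pow_eq_one (p : ℕ) [hp : Fact p.Prime] (P : ℂ[X])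
    (hP : P ≠ 0) (hlt : ∀ i ∈ P.support, i < p) (T : Finset ℂ)
    (hT : ∀ z ∈ T, z ^ p = 1 ∧ P.IsRoot z) : T.card < P.support.card := by
  obtain ⟨V, hV⟩ := exists_valuationSubring_charP_residueField p
  obtain ⟨i, hi, hmax⟩ := P.support.exists_max_image (fun i => V.valuation (P.coeff i))
    (support_nonempty.mpr hP)
  have hi0 : P.coeff i ≠ 0 := mem_support_iff.mp hi
  have hlift (j : ℕ) : (P.coeff i)⁻¹ * P.coeff j ∈ V := by
    rw [← V.valuation_le_one_iff, map_mul, map_inv₀]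
    by_cases hj : j ∈ P.support
    · have hne : V.valuation (P.coeff i) ≠ 0 := (Valuation.ne_zero_iff _).mpr hi0
      exact inv_mul_le_one_of_le₀ (hmax j hj) zero_le
    · simp [notMem_support_iff.mp hj]
  have hQ : C (P.coeff i)⁻¹ * P ∈ lifts V.subtype := by
    rw [lifts_iff_coeff_lifts]
    intro j
    rw [coeff_C_mul]
    exact ⟨⟨_, hlift j⟩, rfl⟩
  obtain ⟨Q, hQ⟩ := (mem_lifts _).mp hQ
  have hQcoeff (j : ℕ) : (Q.coeff j : ℂ) = (P.coeff i)⁻¹ * P.coeff j := by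
    rw [← coeff_C_mul, ← hQ, coeff_map]
    rfl
  have hQi : Q.coeff i = 1 := Subtype.ext (by rw [hQcoeff, inv_mul_cancel₀ hi0]; rfl)
  have hQ0 : Q ≠ 0 := by rintro rfl; simp at hQi
  have hQsupp : Q.support ⊆ P.support := by
    intro j hj
    rw [mem_support_iff] at hj ⊢
    intro h
    exact hj (Subtype.ext (by rw [hQcoeff, h, mul_zero]; rfl))
  have hTV (z : ℂ) (hz : z ∈ T) : z ∈ V := by
    rw [← V.valuation_le_one_iff]
    have h1 : V.valuation z ^ p = 1 := by rw [← map_pow, (hT z hz).1, map_one]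
    exact ((pow_eq_one_iff_of_nonneg zero_le hp.out.ne_zero).mp h1).le
  let T' : Finset V := T.attach.map
    ⟨fun z => ⟨z.1, hTV z.1 z.2⟩, fun a b h => Subtype.ext (Subtype.mk.inj h)⟩
  have hT'card : T'.card = T.card := by simp [T']
  have hT' (w : V) (hw : w ∈ T') : (w : ℂ) ∈ T := by
    obtain ⟨z, -, rfl⟩ := Finset.mem_map.mp hw
    exact z.2
  have hdvd : (∏ w ∈ T', (X - C w)) ∣ Q := by
    refine (Multiset.prod_X_sub_C_dvd_iff_le_roots hQ0 T'.val).mpr ?_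
    rw [Multiset.le_iff_subset T'.nodup]
    intro w hw
    rw [mem_roots hQ0]
    have hroot : (Q.map V.subtype).IsRoot (V.subtype w) := by
      have hw0 : P.eval (V.subtype w) = 0 := (hT w (hT' w hw)).2
      rw [hQ, IsRoot, eval_mul, hw0, mul_zero]
    exact hroot.of_map V.subtype_injective
  let π := IsLocalRing.residue V
  have hπ (w : V) (hw : w ∈ T') : π w = 1 := by
    have h1 : w ^ p = 1 := Subtype.ext (by simpa using (hT w (hT' w hw)).1)
    have h2 : π w ^ p = 1 := by rw [← map_pow, h1, map_one]
    have : ExpChar (IsLocalRing.ResidueField V) p := ExpChar.prime hp.out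
    refine frobenius_inj (IsLocalRing.ResidueField V) p ?_
    simpa [frobenius_def] using h2
  have hdvd' : (X - 1) ^ T.card ∣ Q.map π := by
    have h := map_dvd (mapRingHom π) hdvd
    rw [map_prod] at h
    rw [← hT'card, ← Finset.prod_const]
    rw [coe_mapRingHom] at h
    convert h using 1
    refine Finset.prod_congr rfl fun w hw => ?_
    simp [hπ w hw]
  have hsub : (Q.map π).support ⊆ P.support := (support_map_subset _ _).trans hQsupp
  have hne : Q.map π ≠ 0 := by
    intro h
    have := congrArg (fun R => coeff R i) h
    simp [hQi] at this
  exact (card_support_gt_of_X_sub_one_pow_dvd p _ _ hne (fun j hj => hlt j (hsub hj))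
    hdvd').trans_le (Finset.card_le_card hsub)

lemma AddChar.zmod_apply_neg (p : ℕ) [NeZero p] (χ : AddChar (ZMod p) ℂ) (x : ZMod p) :
    χ (-x) = χ (-1) ^ x.val := by
  rw [← AddChar.map_nsmul_eq_pow]
  congr 1
  simp

lemma AddChar.zmod_apply_neg_one_pow (p : ℕ) [NeZero p] (χ : AddChar (ZMod p) ℂ) :
    χ (-1) ^ p = 1 := by
  rw [← AddChar.map_nsmul_eq_pow]
  simp

lemma AddChar.zmod_apply_neg_one_injective (p : ℕ) [NeZero p] :
    Injective fun χ : AddChar (ZMod p) ℂ => χ (-1) := by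
  intro χ ψ h
  ext x
  have h' : χ (-1) = ψ (-1) := h
  rw [← neg_neg x, AddChar.zmod_apply_neg p χ, AddChar.zmod_apply_neg p ψ, h']

lemma AddChar.natCard_zmod (p : ℕ) [NeZero p] : Nat.card (AddChar (ZMod p) ℂ) = p := by
  rw [Nat.card_eq_fintype_card, AddChar.card_eq, ZMod.card]

/-- The Fourier transform on `ZMod p` as evaluation of a polynomial. -/
lemma dft_coeff_val (p : ℕ) [NeZero p] (P : ℂ[X]) (hP : P.natDegree < p)
    (χ : AddChar (ZMod p) ℂ) :
    dft (ZMod p) (fun x => P.coeff x.val) χ = P.eval (χ (-1)) := by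
  rw [eval_eq_sum_range' hP, dft]
  refine Finset.sum_bij' (fun x _ => x.val) (fun i _ => (i : ZMod p)) ?_ ?_ ?_ ?_ ?_
  · intro x _
    exact Finset.mem_range.mpr (ZMod.val_lt x)
  · simp
  · simp
  · intro i hi
    exact ZMod.val_cast_of_lt (Finset.mem_range.mp hi)
  · intro x _
    rw [AddChar.zmod_apply_neg]

/-- Every function on `ZMod p` is the coefficient function of a polynomial of degree less
than `p`, with the same number of nonzero values. -/
lemma exists_coeff_val_eq (p : ℕ) [NeZero p] (f : ZMod p → ℂ) :
    ∃ P : ℂ[X], P.natDegree < p ∧ (fun x : ZMod p => P.coeff x.val) = f := by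
  have hp : 0 < p := NeZero.pos p
  refine ⟨∑ i ∈ Finset.range p, C (f i) * X ^ i, ?_, ?_⟩
  · refine (natDegree_sum_le_of_forall_le (n := p - 1) _ _ fun i hi => ?_).trans_lt (by omega)
    have := Finset.mem_range.mp hi
    exact (natDegree_C_mul_X_pow_le _ _).trans (by omega)
  · ext x
    simp [finsetSum_coeff, coeff_C_mul, coeff_X_pow, ZMod.val_lt]

lemma ncard_support_coeff_val (p : ℕ) [NeZero p] (P : ℂ[X]) (hP : P.natDegree < p) :
    (Function.support fun x : ZMod p => P.coeff x.val).ncard = P.support.card := by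
  rw [← Set.ncard_coe_finset, ← Set.ncard_image_of_injective _ (ZMod.val_injective p)]
  congr 1
  ext i
  simp only [Set.mem_image, mem_support, Finset.mem_coe, mem_support_iff]
  constructor
  · rintro ⟨x, hx, rfl⟩
    exact hx
  · intro hi
    have hip : i < p := (le_natDegree_of_ne_zero hi).trans_lt hP
    exact ⟨i, by rwa [ZMod.val_cast_of_lt hip], ZMod.val_cast_of_lt hip⟩

/-- The uncertainty principle on `ZMod p` for `p` prime. -/
lemma succ_le_ncard_support_add_ncard_support_dft (p : ℕ) [Fact p.Prime] (f : ZMod p → ℂ)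
    (hf : f ≠ 0) : p + 1 ≤ (Function.support f).ncard + (Function.support (dft (ZMod p) f)).ncard := by
  classical
  obtain ⟨P, hP, rfl⟩ := exists_coeff_val_eq p f
  have hP0 : P ≠ 0 := by
    rintro rfl
    exact hf (by ext; simp)
  rw [ncard_support_coeff_val p P hP]
  set S := Function.support (dft (ZMod p) fun x => P.coeff x.val) with hS
  have hlt := card_lt_card_support_of_isRoot_of_pow_eq_one p P hP0
    (fun i hi => (le_natDegree_of_mem_supp i hi).trans_lt hP)
    (Sᶜ.toFinset.image fun χ => χ (-1)) (by
      intro z hz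
      obtain ⟨χ, hχ, rfl⟩ := Finset.mem_image.mp hz
      refine ⟨AddChar.zmod_apply_neg_one_pow p χ, ?_⟩
      rw [IsRoot, ← dft_coeff_val p P hP]
      simpa [hS] using hχ)
  rw [Finset.card_image_of_injective _ (AddChar.zmod_apply_neg_one_injective p),
    ← Set.ncard_eq_toFinset_card'] at hlt
  have hsum := Set.ncard_add_ncard_compl S
  rw [AddChar.natCard_zmod] at hsum
  omega

/-- The uncertainty principle on `ZMod p` is sharp. -/
lemma exists_ncard_support_le_ncard_support_dft_le (p : ℕ) [NeZero p] (j : ℕ) (hj : 1 ≤ j)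
    (hjp : j ≤ p) : ∃ f : ZMod p → ℂ, f ≠ 0 ∧ (Function.support f).ncard ≤ j ∧
      (Function.support (dft (ZMod p) f)).ncard ≤ p - j + 1 := by
  classical
  obtain ⟨T, -, hT⟩ := Finset.exists_subset_card_eq
    (s := (Finset.univ : Finset (AddChar (ZMod p) ℂ))) (n := j - 1)
    (by rw [Finset.card_univ, AddChar.card_eq, ZMod.card]; omega)
  set P : ℂ[X] := ∏ χ ∈ T, (X - C (χ (-1))) with hPdef
  have hmonic : P.Monic := monic_prod_of_monic _ _ fun χ _ => monic_X_sub_C _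
  have hdeg : P.natDegree = j - 1 := by
    rw [hPdef, natDegree_prod_of_monic _ _ fun χ _ => monic_X_sub_C _]
    simp [hT]
  have hlt : P.natDegree < p := by omega
  have hcard := ncard_support_coeff_val p P hlt
  refine ⟨fun x => P.coeff x.val, ?_, ?_, ?_⟩
  · intro h0
    have h1 : Function.support (fun x : ZMod p => P.coeff x.val) = ∅ := support_eq_empty_iff.mpr h0
    rw [h1, Set.ncard_empty] at hcard
    exact hmonic.ne_zero (card_support_eq_zero.mp hcard.symm)
  · rw [hcard]
    have := P.card_supp_le_succ_natDegree
    omega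
  · have hsub : Function.support (dft (ZMod p) fun x => P.coeff x.val) ⊆ (T : Set _)ᶜ := by
      intro χ hχ hχT
      rw [mem_support, dft_coeff_val p P hlt, hPdef, eval_prod] at hχ
      exact hχ (Finset.prod_eq_zero hχT (by simp))
    have h1 := Set.ncard_le_ncard hsub
    have h2 := Set.ncard_add_ncard_compl (T : Set (AddChar (ZMod p) ℂ))
    rw [AddChar.natCard_zmod, Set.ncard_coe_finset, hT] at h2
    omega

end Polynomial

/-- Characters of a product are pairs of characters. -/
def AddChar.prodEquiv (A B : Type*) [AddCommGroup A] [AddCommGroup B] :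
    AddChar A ℂ × AddChar B ℂ ≃ AddChar (A × B) ℂ where
  toFun χ := χ.1.compAddMonoidHom (AddMonoidHom.fst A B) *
    χ.2.compAddMonoidHom (AddMonoidHom.snd A B)
  invFun χ := (χ.compAddMonoidHom (AddMonoidHom.inl A B), χ.compAddMonoidHom (AddMonoidHom.inr A B))
  left_inv χ := by ext x <;> simp
  right_inv χ := by
    ext x
    simp [← AddChar.map_add_eq_mul]

lemma AddChar.prodEquiv_apply (A B : Type*) [AddCommGroup A] [AddCommGroup B]
    (χ : AddChar A ℂ) (ψ : AddChar B ℂ) (x : A) (y : B) :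
    AddChar.prodEquiv A B (χ, ψ) (x, y) = χ x * ψ y := rfl

section Product

variable {A B : Type*} [AddCommGroup A] [AddCommGroup B] [Fintype A] [Fintype B]

lemma dft_prod_apply (f : A × B → ℂ) (χ : AddChar A ℂ) (ψ : AddChar B ℂ) :
    dft (A × B) f (AddChar.prodEquiv A B (χ, ψ)) =
      dft A (fun x => dft B (fun y => f (x, y)) ψ) χ := by
  simp only [dft, Fintype.sum_prod_type, Prod.neg_mk, AddChar.prodEquiv_apply, Finset.sum_mul]
  refine Finset.sum_congr rfl fun x _ => Finset.sum_congr rfl fun y _ => ?_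
  ring

lemma ncard_support_dft_prod (f : A × B → ℂ) :
    (support (dft (A × B) f)).ncard =
      {q : AddChar A ℂ × AddChar B ℂ |
        dft A (fun x => dft B (fun y => f (x, y)) q.2) q.1 ≠ 0}.ncard := by
  rw [← Set.ncard_image_of_injective _ (AddChar.prodEquiv A B).injective]
  congr 1
  ext χ
  obtain ⟨q, rfl⟩ := (AddChar.prodEquiv A B).surjective χ
  rw [(AddChar.prodEquiv A B).injective.mem_set_image]
  simp [← dft_prod_apply]

lemma ncard_support_dft_mul (a : A → ℂ) (b : B → ℂ) :
    (support (dft (A × B) fun q => a q.1 * b q.2)).ncard =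
      (support (dft A a)).ncard * (support (dft B b)).ncard := by
  rw [ncard_support_dft_prod, ← Set.ncard_prod]
  congr 1
  ext ⟨χ, ψ⟩
  have h : dft A (fun x => dft B (fun y => a x * b y) ψ) χ = dft A a χ * dft B b ψ := by
    simp only [dft]
    rw [Finset.sum_mul_sum]
    simp only [Finset.sum_mul]
    refine Finset.sum_congr rfl fun x _ => Finset.sum_congr rfl fun y _ => ?_
    ring
  simp [h]

end Product

lemma ncard_mul_le_ncard_of_le_ncard_fiber {α β : Type*} [Finite α] [Finite β] (S : Set (α × β))
    (T : Set β) (m : ℕ) (h : ∀ b ∈ T, m ≤ {a | (a, b) ∈ S}.ncard) : T.ncard * m ≤ S.ncard := by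
  classical
  have := Fintype.ofFinite α
  have := Fintype.ofFinite β
  rw [Set.ncard_eq_toFinset_card' S, Set.ncard_eq_toFinset_card' T, mul_comm]
  calc m * T.toFinset.card
      ≤ (S.toFinset.filter fun q => q.2 ∈ T).card := by
        refine Finset.mul_card_image_le_card_of_maps_to (f := Prod.snd)
          (fun q hq => by simpa using (Finset.mem_filter.mp hq).2) m fun b hb => ?_
        have hbT : b ∈ T := by simpa using hb
        refine (h b hbT).trans ?_
        rw [Set.ncard_eq_toFinset_card']
        refine Finset.card_le_card_of_injOn (fun a => (a, b)) (fun a ha => ?_) fun a _ a' _ h => ?_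
        · simpa [hbT] using ha
        · exact (Prod.mk.inj h).1
    _ ≤ S.toFinset.card := Finset.card_filter_le _ _

lemma sub_add_one_mul_bounds (p s t k N : ℕ) (hs : 1 ≤ s) (ht : 1 ≤ t) (hsp : s ≤ p) (htp : t ≤ p)
    (hst : t * s ≤ k) (hN : (p + 1 - s) * (p + 1 - t) ≤ N) :
    p * (p + 1) ≤ N + p * k ∧ p * (p + 1) ≤ p * N + k := by
  zify [hsp.trans p.le_succ, htp.trans p.le_succ] at *
  have hp0 : (0 : ℤ) ≤ p := by positivity
  constructor
  · have h1 := mul_nonneg (add_nonneg hp0 zero_le_one)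
      (mul_nonneg (sub_nonneg.mpr hs) (sub_nonneg.mpr ht))
    have h2 := mul_le_mul_of_nonneg_left hst hp0
    linarith
  · have h1 := mul_nonneg (add_nonneg hp0 zero_le_one)
      (mul_nonneg (sub_nonneg.mpr hsp) (sub_nonneg.mpr htp))
    have h2 := mul_le_mul_of_nonneg_left hN hp0
    linarith

/-- The lower bounds for the size of the spectrum in `ZMod p × ZMod p`. -/
lemma le_ncard_support_dft_zmod_prod (p : ℕ) [Fact p.Prime] (f : ZMod p × ZMod p → ℂ) (hf : f ≠ 0)
    (k : ℕ) (hk : (support f).ncard ≤ k) :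
    p * (p + 1) ≤ (support (dft _ f)).ncard + p * k ∧
      p * (p + 1) ≤ p * (support (dft _ f)).ncard + k := by
  let T : Set (ZMod p) := {x | (fun y => f (x, y)) ≠ 0}
  have hTne : T.Nonempty := by
    obtain ⟨⟨x, y⟩, hxy⟩ := Function.ne_iff.mp hf
    exact ⟨x, fun h => hxy (congrFun h y)⟩
  obtain ⟨x₀, hx₀, hmin⟩ := T.exists_min_image
    (fun x => (support fun y => f (x, y)).ncard) T.toFinite hTne
  set s := (support fun y => f (x₀, y)).ncard with hs
  have hcard (U : Set (ZMod p)) : U.ncard ≤ p := by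
    simpa using Set.ncard_le_card U
  have hs1 : 1 ≤ s := (Set.ncard_pos).mpr (support_nonempty_iff.mpr hx₀)
  have ht1 : 1 ≤ T.ncard := (Set.ncard_pos).mpr hTne
  have hst : T.ncard * s ≤ k := by
    refine le_trans ?_ hk
    rw [← Set.ncard_image_of_injective (support f) Prod.swap_injective]
    refine ncard_mul_le_ncard_of_le_ncard_fiber _ T s fun x hx => (hmin x hx).trans_eq ?_
    congr 1
    ext y
    simp
  refine sub_add_one_mul_bounds p s T.ncard k _ hs1 ht1 (hcard _) (hcard _) hst ?_
  rw [ncard_support_dft_prod]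
  let Ψ := support (dft (ZMod p) fun y => f (x₀, y))
  have hΨ : p + 1 - s ≤ Ψ.ncard := by
    have := succ_le_ncard_support_add_ncard_support_dft p (fun y => f (x₀, y)) hx₀
    exact Nat.sub_le_iff_le_add'.mpr this
  refine (Nat.mul_le_mul_right _ hΨ).trans
    (ncard_mul_le_ncard_of_le_ncard_fiber _ Ψ _ fun ψ hψ => ?_)
  let g : ZMod p → ℂ := fun x => dft (ZMod p) (fun y => f (x, y)) ψ
  have hg : g ≠ 0 := fun h => hψ (congrFun h x₀)
  have hgT : support g ⊆ T := by
    intro x hx h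
    refine hx ?_
    have h' (y : ZMod p) : f (x, y) = 0 := congrFun h y
    simp [g, dft, h']
  have h1 := succ_le_ncard_support_add_ncard_support_dft p g hg
  have h2 := Set.ncard_le_ncard hgT
  change p + 1 - T.ncard ≤ (support (dft (ZMod p) g)).ncard
  omega

/-- Products of extremal functions on `ZMod p` bound `theta` from above. -/
lemma theta_zmod_prod_le (p : ℕ) [NeZero p] (i j k : ℕ) (hi : 1 ≤ i) (hip : i ≤ p) (hj : 1 ≤ j)
    (hjp : j ≤ p) (hk : i * j ≤ k) :
    theta (ZMod p × ZMod p) k ≤ (p - i + 1) * (p - j + 1) := by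
  obtain ⟨a, ha0, has, had⟩ := exists_ncard_support_le_ncard_support_dft_le p i hi hip
  obtain ⟨b, hb0, hbs, hbd⟩ := exists_ncard_support_le_ncard_support_dft_le p j hj hjp
  obtain ⟨x, hx⟩ := Function.ne_iff.mp ha0
  obtain ⟨y, hy⟩ := Function.ne_iff.mp hb0
  refine le_trans (b := (support (dft _ a)).ncard * (support (dft _ b)).ncard)
    (Nat.sInf_le ?_) (Nat.mul_le_mul had hbd)
  refine ⟨fun q => a q.1 * b q.2, fun h => ?_, ?_, ncard_support_dft_mul a b⟩
  · exact mul_ne_zero hx hy (congrFun h (x, y))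
  · have h : (support fun q : ZMod p × ZMod p => a q.1 * b q.2) = support a ×ˢ support b := by
      ext q
      simp
    rw [h, Set.ncard_prod]
    exact (Nat.mul_le_mul has hbs).trans hk

/-- The value `theta G k` is attained for `1 ≤ k`. -/
lemma exists_ncard_support_dft_eq_theta (G : Type*) [AddCommGroup G] [Fintype G] (k : ℕ)
    (hk : 1 ≤ k) :
    ∃ f : G → ℂ, f ≠ 0 ∧ (support f).ncard ≤ k ∧ (support (dft G f)).ncard = theta G k := by
  classical
  refine Nat.sInf_mem
    (s := {l | ∃ f : G → ℂ, f ≠ 0 ∧ (support f).ncard ≤ k ∧ (support (dft G f)).ncard = l})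
    ⟨_, Pi.single 0 1, ?_, ?_, rfl⟩
  · simp
  · simpa using hk

/-- Meshulam's function for `G = ℤ/pℤ × ℤ/pℤ`, `p` prime; `⌊k/p⌋` is natural division. -/
theorem theta_p_times_p (p : ℕ) [Fact p.Prime] :
    (∀ k : ℕ, 1 ≤ k → k ≤ p →
      theta (ZMod p × ZMod p) k = p * (p - k + 1)) ∧
    (∀ k : ℕ, p ≤ k → k ≤ p ^ 2 →
      theta (ZMod p × ZMod p) k = p - k / p + 1) := by
  have hp : 0 < p := NeZero.pos p
  constructor
  · intro k hk hkp
    refine le_antisymm ?_ ?_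
    · have := theta_zmod_prod_le p 1 k k le_rfl hp hk hkp (one_mul k).le
      rwa [Nat.sub_add_cancel hp] at this
    · obtain ⟨f, hf, hfk, hfθ⟩ := exists_ncard_support_dft_eq_theta (ZMod p × ZMod p) k hk
      have := (le_ncard_support_dft_zmod_prod p f hf k hfk).1
      rw [← hfθ]
      obtain ⟨d, rfl⟩ := Nat.exists_eq_add_of_le hkp
      rw [Nat.add_sub_cancel_left]
      nlinarith
  · intro k hpk hk
    have hj : 1 ≤ k / p := (Nat.one_le_div_iff hp).mpr hpk
    have hjp : k / p ≤ p := Nat.div_le_of_le_mul (by rwa [← sq])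
    refine le_antisymm ?_ ?_
    · simpa using theta_zmod_prod_le p p (k / p) k hp le_rfl hj hjp (Nat.mul_div_le k p)
    · obtain ⟨f, hf, hfk, hfθ⟩ := exists_ncard_support_dft_eq_theta (ZMod p × ZMod p) k
        (hp.trans_le hpk)
      have h1 := (le_ncard_support_dft_zmod_prod p f hf k hfk).2
      rw [← hfθ]
      have h2 : k < p * (k / p + 1) := Nat.lt_mul_div_succ k hp
      have h3 : p * (p + 1) < p * ((support (dft _ f)).ncard + (k / p + 1)) := by linarith
      have h4 := Nat.lt_of_mul_lt_mul_left h3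
      omega
end

section
/- Let p be a prime number and G = ℤ/p²ℤ. Then θ(k, G) = p(p - k + 1) for 1 ≤ k ≤ p, and θ(k, G) = p - ⌊k/p⌋ + 1 for p ≤ k ≤ p². Moreover, there exist equality cases for (k, G) if and only if θ(k, G) < θ(k-1, G) or k = p² - 1. -/
open Function

/-- The Fourier transform on `ℤ/nℤ`: `f̂(y) = ∑ x, f x * e^{-2πi x y / n}`. -/
noncomputable def zdft (n : ℕ) [NeZero n] (f : ZMod n → ℂ) : ZMod n → ℂ :=
  fun y => ∑ x : ZMod n,
    f x * Complex.exp (-2 * Real.pi * Complex.I * ((x.val * y.val : ℕ) : ℂ) / (n : ℂ))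

/-- Meshulam's function `θ(k, ℤ/nℤ)`: the minimal size of the spectrum of a nonzero function
on `ℤ/nℤ` whose support has size at most `k`. -/
noncomputable def ztheta (n : ℕ) [NeZero n] (k : ℕ) : ℕ :=
  sInf {l | ∃ f : ZMod n → ℂ, f ≠ 0 ∧ (support f).ncard ≤ k ∧ (support (zdft n f)).ncard = l}

/-- An equality case for `(k, ℤ/nℤ)`: a nonzero function with support of size exactly `k`
and spectrum of minimal size `θ(k, ℤ/nℤ)`. -/
def IsZEqualityCase (n : ℕ) [NeZero n] (k : ℕ) (f : ZMod n → ℂ) : Prop :=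
  f ≠ 0 ∧ (support f).ncard = k ∧ (support (zdft n f)).ncard = ztheta n k

open Polynomial in
/-- Over a domain of characteristic `p`, a nonzero polynomial of degree less than `p` with at most
`n` terms is not divisible by `(X - 1) ^ n`. -/
theorem Polynomial.eq_zero_of_X_sub_one_pow_dvd {R : Type*} [CommRing R] [IsDomain R] {p : ℕ}
    [CharP R p] (n : ℕ) (g : R[X]) (hdeg : ∀ i ∈ g.support, i < p) (hcard : g.support.card ≤ n)
    (hdvd : (X - 1) ^ n ∣ g) : g = 0 := by
  induction n generalizing g with
  | zero => simpa using hcard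
  | succ n ih =>
    by_contra hg
    obtain ⟨y, hy⟩ := Polynomial.support_nonempty.2 hg
    have hcoeff : ∀ i : ℕ, (X * derivative g - C (y : R) * g).coeff i =
        ((i : R) - y) * g.coeff i := by
      intro i
      rcases i with _ | i
      · simp
      · simp [coeff_X_mul, coeff_derivative]
        ring
    have hsub : (X * derivative g - C (y : R) * g).support ⊆ g.support.erase y := by
      intro i hi
      rw [mem_support_iff, hcoeff] at hi
      rw [Finset.mem_erase, mem_support_iff]
      refine ⟨?_, right_ne_zero_of_mul hi⟩
      rintro rfl
      simp at hi
    have hzero : X * derivative g - C (y : R) * g = 0 := by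
      apply ih
      · exact fun i hi => hdeg i (Finset.mem_of_mem_erase (hsub hi))
      · have := Finset.card_le_card hsub
        rw [Finset.card_erase_of_mem hy] at this
        omega
      · refine dvd_sub (Dvd.dvd.mul_left ?_ _)
          (Dvd.dvd.mul_left ((pow_dvd_pow _ n.le_succ).trans hdvd) _)
        simpa using pow_sub_one_dvd_derivative_of_pow_dvd hdvd
    have hmono : g = monomial y (g.coeff y) := by
      ext i
      rw [coeff_monomial]
      split_ifs with h
      · rw [h]
      · by_contra hi
        have h0 := hcoeff i
        rw [hzero, coeff_zero, eq_comm, mul_eq_zero, or_iff_left hi, sub_eq_zero] at h0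
        exact h (CharP.natCast_injOn_Iio R p (hdeg y hy) (hdeg i (mem_support_iff.2 hi)) h0.symm)
    have heval : g.eval 1 = 0 := by
      obtain ⟨q, hq⟩ := hdvd
      rw [hq]
      simp
    rw [hmono, eval_monomial, one_pow, mul_one] at heval
    exact mem_support_iff.1 hy heval

open Polynomial NumberField in
/-- **Chebotarev's theorem on roots of unity**: the minors of the Fourier matrix of prime order
do not vanish. -/
theorem IsPrimitiveRoot.det_pow_mul_ne_zero_of_cyclotomic {p : ℕ} [Fact p.Prime] {K : Type*}
    [Field K] [NumberField K] [IsCyclotomicExtension {p} ℚ K] {z : K} (hz : IsPrimitiveRoot z p)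
    {n : ℕ} {x y : Fin n → ℕ} (hx : Injective x) (hy : Injective y) (hxp : ∀ i, x i < p)
    (hyp : ∀ i, y i < p) : (Matrix.of fun i j => z ^ (x i * y j)).det ≠ 0 := by
  classical
  intro hdet
  set ζ : 𝓞 K := hz.toInteger with hζ
  have hζprim : IsPrimitiveRoot ζ p := hz.toInteger_isPrimitiveRoot
  have hprime : Prime (ζ - 1) := hz.zeta_sub_one_prime'
  have hdet' : (Matrix.of fun i j => ζ ^ (x i * y j)).det = 0 := by
    apply RingOfIntegers.coe_injective
    rw [map_zero, ← hdet, RingHom.map_det]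
    congr 1
  obtain ⟨v, hv, hMv⟩ := Matrix.exists_mulVec_eq_zero_iff.2 hdet'
  set g : (𝓞 K)[X] := ∑ j, monomial (y j) (v j) with hg
  have hgcoeff : ∀ j, g.coeff (y j) = v j := by
    intro j
    simp [hg, coeff_monomial, hy.eq_iff]
  have hgsupp : g.support ⊆ Finset.univ.image y := by
    intro i hi
    by_contra hi'
    rw [mem_support_iff, hg, finsetSum_coeff] at hi
    refine hi (Finset.sum_eq_zero fun j _ => ?_)
    rw [coeff_monomial, if_neg]
    rintro rfl
    simp at hi'
  have hg0 : g ≠ 0 := by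
    intro h
    apply hv
    ext1 j
    simp [← hgcoeff j, h]
  have hgroot : ∀ i, g.eval (ζ ^ x i) = 0 := by
    intro i
    have := congrFun hMv i
    simp only [Matrix.mulVec, dotProduct, Matrix.of_apply, Pi.zero_apply] at this
    rw [← this, hg, eval_finsetSum]
    exact Finset.sum_congr rfl fun j _ => by rw [eval_monomial, pow_mul, mul_comm]
  have hCπ : ¬ IsUnit (C (ζ - 1)) := fun h => hprime.not_isUnit (isUnit_C.1 h)
  obtain ⟨N, q, hq, hgq⟩ := WfDvdMonoid.max_power_factor' hg0 hCπ
  have hq0 : q ≠ 0 := by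
    rintro rfl
    simp at hq
  have hqsupp : q.support ⊆ Finset.univ.image y := by
    intro i hi
    apply hgsupp
    rw [mem_support_iff] at hi ⊢
    rw [hgq, ← C_pow, coeff_C_mul]
    exact mul_ne_zero (pow_ne_zero _ hprime.ne_zero) hi
  have hqroot : ∀ i, q.IsRoot (ζ ^ x i) := by
    intro i
    have := hgroot i
    rw [hgq, ← C_pow, eval_mul, eval_C, mul_eq_zero] at this
    exact this.resolve_left (pow_ne_zero _ hprime.ne_zero)
  have hinj : Injective fun i => ζ ^ x i := fun i j h =>
    hx (hζprim.pow_inj (hxp i) (hxp j) h)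
  have hdvd : ∏ i, (X - C (ζ ^ x i)) ∣ q := by
    have h1 : (Finset.univ.val.map fun i => ζ ^ x i) ≤ q.roots := by
      rw [Multiset.le_iff_subset (Multiset.Nodup.map hinj Finset.univ.nodup)]
      intro a ha
      obtain ⟨i, -, rfl⟩ := Multiset.mem_map.1 ha
      exact (mem_roots hq0).2 (hqroot i)
    have h2 := (Multiset.prod_X_sub_C_dvd_iff_le_roots hq0 _).2 h1
    rwa [Multiset.map_map] at h2
  let I : Ideal (𝓞 K) := Ideal.span {ζ - 1}
  have hI : I.IsPrime := (Ideal.span_singleton_prime hprime.ne_zero).2 hprime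
  have hchar : CharP (𝓞 K ⧸ I) p := by
    have h0 : ((p : ℕ) : 𝓞 K ⧸ I) = 0 := by
      rw [← map_natCast (Ideal.Quotient.mk I), Ideal.Quotient.eq_zero_iff_mem,
        Ideal.mem_span_singleton]
      exact hz.toInteger_sub_one_dvd_prime'
    have := CharP.ringChar_of_prime_eq_zero (Fact.out : p.Prime) h0
    exact this ▸ ringChar.charP _
  have hζ1 : Ideal.Quotient.mk I ζ = 1 := by
    rw [← map_one (Ideal.Quotient.mk I), Ideal.Quotient.eq]
    exact Ideal.mem_span_singleton_self _
  have hmapsupp : (q.map (Ideal.Quotient.mk I)).support ⊆ Finset.univ.image y :=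
    (support_map_subset _ _).trans hqsupp
  have hmap0 : q.map (Ideal.Quotient.mk I) = 0 := by
    refine Polynomial.eq_zero_of_X_sub_one_pow_dvd (p := p) n _ ?_ ?_ ?_
    · intro i hi
      obtain ⟨j, -, rfl⟩ := Finset.mem_image.1 (hmapsupp hi)
      exact hyp j
    · exact (Finset.card_le_card hmapsupp).trans (Finset.card_image_le.trans (by simp))
    · have := Polynomial.map_dvd (Ideal.Quotient.mk I) hdvd
      simpa [Polynomial.map_prod, hζ1] using this
  apply hq
  rw [C_dvd_iff_dvd_coeff]
  intro i
  rw [← Ideal.mem_span_singleton, ← Ideal.Quotient.eq_zero_iff_mem]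
  simpa using congrArg (fun r => r.coeff i) hmap0

open IntermediateField

/-- The field generated by a complex primitive `n`-th root of unity is cyclotomic. -/
theorem IsPrimitiveRoot.isCyclotomicExtension_adjoin_complex {n : ℕ} [NeZero n] {z : ℂ}
    (hz : IsPrimitiveRoot z n) : IsCyclotomicExtension {n} ℚ ℚ⟮z⟯ := by
  have hint : IsIntegral ℚ z := (hz.isIntegral (NeZero.pos n)).tower_top
  change IsCyclotomicExtension {n} ℚ ℚ⟮z⟯.toSubalgebra
  rw [adjoin_simple_toSubalgebra_of_isAlgebraic hint.isAlgebraic]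
  exact hz.adjoin_isCyclotomicExtension ℚ

/-- The generator of the field generated by a primitive root of unity is a primitive root. -/
theorem IsPrimitiveRoot.gen_adjoin_complex {n : ℕ} {z : ℂ} (hz : IsPrimitiveRoot z n) :
    IsPrimitiveRoot (AdjoinSimple.gen ℚ z) n :=
  IsPrimitiveRoot.of_map_of_injective (f := algebraMap ℚ⟮z⟯ ℂ) (by simpa using hz)
    (algebraMap ℚ⟮z⟯ ℂ).injective

/-- The minors of the Fourier matrix of prime order are nonzero elements of the field generated by
the root of unity. -/
theorem IsPrimitiveRoot.exists_algebraMap_eq_det_pow_mul {p : ℕ} [Fact p.Prime] {z : ℂ}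
    (hz : IsPrimitiveRoot z p) {n : ℕ} {x y : Fin n → ℕ} (hx : Injective x) (hy : Injective y)
    (hxp : ∀ i, x i < p) (hyp : ∀ i, y i < p) :
    ∃ d : ℚ⟮z⟯, d ≠ 0 ∧ algebraMap ℚ⟮z⟯ ℂ d = (Matrix.of fun i j => z ^ (x i * y j)).det := by
  have := hz.isCyclotomicExtension_adjoin_complex
  have : NumberField ℚ⟮z⟯ := IsCyclotomicExtension.numberField {p} ℚ _
  refine ⟨_, hz.gen_adjoin_complex.det_pow_mul_ne_zero_of_cyclotomic hx hy hxp hyp, ?_⟩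
  rw [RingHom.map_det]
  congr 1

/-- Distinct powers below `p` of a primitive `p ^ 2`-th root of unity `w` are independent over
the field generated by `w ^ p`. -/
theorem IsPrimitiveRoot.linearIndependent_pow_adjoin {p : ℕ} [Fact p.Prime] {w : ℂ}
    (hw : IsPrimitiveRoot w (p ^ 2)) :
    LinearIndependent ℚ⟮w ^ p⟯ fun i : Fin p => w ^ (i : ℕ) := by
  have hp : p.Prime := Fact.out
  have hz : IsPrimitiveRoot (w ^ p) p := hw.pow (pow_pos hp.pos 2) (by ring)
  have := hz.isCyclotomicExtension_adjoin_complex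
  have : NumberField ℚ⟮w ^ p⟯ := IsCyclotomicExtension.numberField {p} ℚ _
  let z : ℚ⟮w ^ p⟯ := AdjoinSimple.gen ℚ (w ^ p)
  have hzK : IsPrimitiveRoot z p := hz.gen_adjoin_complex
  have hnp : ∀ b : ℚ⟮w ^ p⟯, b ^ p ≠ z := by
    intro b hb
    have hbp : IsPrimitiveRoot b (p ^ 2) := by
      rw [← orderOf_eq_prime_pow (p := p) (n := 1) (x := b)]
      · exact IsPrimitiveRoot.orderOf b
      · rw [pow_one, hb]
        exact hzK.ne_one hp.one_lt
      · rw [pow_succ, pow_one, pow_mul, hb, hzK.pow_eq_one]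
    have h1 := hbp.lcm_totient_le_finrank hbp (K := ℚ)
      (Polynomial.cyclotomic.irreducible_rat (Nat.lcm_pos (pow_pos hp.pos 2) (pow_pos hp.pos 2)))
    rw [Nat.lcm_self, IsCyclotomicExtension.Rat.finrank p, Nat.totient_prime hp,
      Nat.totient_prime_pow hp two_pos] at h1
    have h2 := hp.two_le
    have h3 : 2 * (p - 1) ≤ p ^ (2 - 1) * (p - 1) := by simpa using Nat.mul_le_mul_right _ h2
    omega
  have hirr := X_pow_sub_C_irreducible_of_prime hp hnp
  have hmin : minpoly ℚ⟮w ^ p⟯ w = Polynomial.X ^ p - Polynomial.C z := by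
    refine (minpoly.eq_of_irreducible_of_monic hirr ?_ ?_).symm
    · simp [z]
    · exact Polynomial.monic_X_pow_sub_C _ hp.ne_zero
  have := linearIndependent_pow (K := ℚ⟮w ^ p⟯) w
  rw [hmin, Polynomial.natDegree_X_pow_sub_C] at this
  exact this

/-- A vector killed by `n` rows of the Fourier matrix of order `p` and by a row of powers of a
primitive `p ^ 2`-th root of unity with exponents distinct modulo `p` vanishes. -/
theorem IsPrimitiveRoot.eq_zero_of_sum_pow_eq_zero {p : ℕ} [Fact p.Prime] {w : ℂ}
    (hw : IsPrimitiveRoot w (p ^ 2)) {n : ℕ} {x : Fin n → ℕ} {y e : Fin (n + 1) → ℕ}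
    (hx : Injective x) (hy : Injective y) (hxp : ∀ i, x i < p) (hyp : ∀ i, y i < p)
    (he : Injective fun i => e i % p) {b : Fin (n + 1) → ℂ}
    (hb : ∀ i, ∑ j, (w ^ p) ^ (x i * y j) * b j = 0) (hb' : ∑ j, w ^ e j * b j = 0) : b = 0 := by
  have hp : p.Prime := Fact.out
  have hz : IsPrimitiveRoot (w ^ p) p := hw.pow (pow_pos hp.pos 2) (by ring)
  by_contra hb0
  let M : Matrix (Fin (n + 1)) (Fin (n + 1)) ℂ :=
    Matrix.of (Fin.cons (fun j => w ^ e j) fun i j => (w ^ p) ^ (x i * y j))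
  have hdet : M.det = 0 := by
    refine Matrix.exists_mulVec_eq_zero_iff.1 ⟨b, hb0, ?_⟩
    ext i
    refine Fin.cases ?_ (fun i => ?_) i
    · simpa [M, Matrix.mulVec, dotProduct] using hb'
    · simpa [M, Matrix.mulVec, dotProduct] using hb i
  have hminor : ∀ j : Fin (n + 1), ∃ d : ℚ⟮w ^ p⟯, d ≠ 0 ∧
      algebraMap ℚ⟮w ^ p⟯ ℂ d = (M.submatrix Fin.succ j.succAbove).det := fun j =>
    hz.exists_algebraMap_eq_det_pow_mul hx (hy.comp Fin.succAbove_right_injective) hxp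
      fun i => hyp _
  choose d hd0 hd using hminor
  rw [Matrix.det_succ_row_zero] at hdet
  have hli := hw.linearIndependent_pow_adjoin.comp
    (fun j => (⟨e j % p, Nat.mod_lt _ hp.pos⟩ : Fin p)) fun i j h => he (Fin.mk.inj h)
  let z : ℚ⟮w ^ p⟯ := AdjoinSimple.gen ℚ (w ^ p)
  have hzK : IsPrimitiveRoot z p := hz.gen_adjoin_complex
  have hcoeff := Fintype.linearIndependent_iff.1 hli
    (fun j => (-1) ^ (j : ℕ) * z ^ (e j / p) * d j) ?_ 0
  · simp [hd0, hzK.ne_zero hp.ne_zero] at hcoeff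
  · rw [← hdet]
    refine Finset.sum_congr rfl fun j _ => ?_
    rw [Algebra.smul_def, map_mul, map_mul, hd]
    have : w ^ e j = (w ^ p) ^ (e j / p) * w ^ (e j % p) := by
      rw [← pow_mul, ← pow_add, Nat.div_add_mod]
    simp [M, z, this]
    ring

/-- Summing along the order embedding of a finite set is summing over the set. -/
theorem Finset.sum_orderEmbOfFin {α M : Type*} [LinearOrder α] [AddCommMonoid M] (s : Finset α)
    {k : ℕ} (h : s.card = k) (F : α → M) : ∑ j, F (s.orderEmbOfFin h j) = ∑ u ∈ s, F u := by
  rw [← Finset.sum_coe_sort s]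
  exact (s.orderIsoOfFin h).toEquiv.sum_comp fun u : s => F u

open Classical in
/-- **Uncertainty principle on `ℤ/pℤ`** (Biró, Meshulam, Tao): the transform of a nonzero function
has fewer zeros than the function has nonzero values. -/
theorem IsPrimitiveRoot.card_zeros_lt_card_support {p : ℕ} [Fact p.Prime] {z : ℂ}
    (hz : IsPrimitiveRoot z p) {h : Fin p → ℂ} (hh : h ≠ 0) :
    (Finset.univ.filter fun t : Fin p => ∑ u : Fin p, z ^ (t * u : ℕ) * h u = 0).card <
      (Finset.univ.filter fun u => h u ≠ 0).card := by
  by_contra! hle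
  set S : Finset (Fin p) := {u | h u ≠ 0} with hS
  set T : Finset (Fin p) := {t | ∑ u : Fin p, z ^ (t * u : ℕ) * h u = 0} with hT
  obtain ⟨T', hT'T, hT'⟩ := Finset.exists_subset_card_eq hle
  let y := S.orderEmbOfFin rfl
  let x := T'.orderEmbOfFin hT'
  obtain ⟨d, hd, hdet⟩ := hz.exists_algebraMap_eq_det_pow_mul (x := fun i => (x i : ℕ))
    (y := fun j => (y j : ℕ)) (Fin.val_injective.comp x.injective)
    (Fin.val_injective.comp y.injective) (fun i => (x i).2) (fun j => (y j).2)
  have hdet0 : (Matrix.of fun i j => z ^ ((x i : ℕ) * (y j : ℕ))).det ≠ 0 := by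
    rw [← hdet]
    simpa using hd
  have hker := Matrix.eq_zero_of_mulVec_eq_zero hdet0 (v := fun j => h (y j)) ?_
  · obtain ⟨u, hu⟩ := Function.ne_iff.1 hh
    have huS : u ∈ S := by simpa [hS] using hu
    rw [← Finset.mem_coe, ← Finset.range_orderEmbOfFin S rfl] at huS
    obtain ⟨j, rfl⟩ := huS
    exact hu (congrFun hker j)
  · ext i
    have hi : x i ∈ T := hT'T (Finset.orderEmbOfFin_mem _ _ _)
    rw [hT, Finset.mem_filter] at hi
    rw [Pi.zero_apply, ← hi.2, ← Finset.sum_subset (Finset.subset_univ S)]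
    · simp only [Matrix.mulVec, dotProduct, Matrix.of_apply]
      exact S.sum_orderEmbOfFin rfl fun u => z ^ ((x i : ℕ) * u : ℕ) * h u
    · intro u _ hu
      simp only [hS, Finset.mem_filter, Finset.mem_univ, true_and, not_not] at hu
      simp [hu]

/-- If a function on `ℤ/p²ℤ` has `n + 1` nonzero values, at points distinct modulo `p`, and its
transform has `n` zeros in one coset of `pℤ/p²ℤ`, then the transform has no zero in the other
cosets. -/
theorem IsPrimitiveRoot.sum_ne_zero_of_card_zeros {p : ℕ} [Fact p.Prime] {w : ℂ}
    (hw : IsPrimitiveRoot w (p ^ 2)) {α : Fin p → ℂ} (v : Fin p → Fin p) {n : ℕ}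
    {S T : Finset (Fin p)} (hS : ∀ u, u ∈ S ↔ α u ≠ 0) (hScard : S.card = n + 1)
    {r₀ r₁ t₁ : Fin p} (hr : r₀ ≠ r₁) (hTcard : n ≤ T.card)
    (hT : ∀ t ∈ T, ∑ u : Fin p, w ^ ((r₀ + p * t) * (u + p * v u) : ℕ) * α u = 0) :
    ∑ u : Fin p, w ^ ((r₁ + p * t₁) * (u + p * v u) : ℕ) * α u ≠ 0 := by
  intro h₁
  have hp : p.Prime := Fact.out
  have hrestrict : ∀ F : Fin p → ℂ, ∑ u, F u * α u = 0 → ∑ u ∈ S, F u * α u = 0 := by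
    intro F hF
    rw [← hF]
    refine Finset.sum_subset (Finset.subset_univ S) fun u _ hu => ?_
    rw [hS, not_not] at hu
    rw [hu, mul_zero]
  obtain ⟨T', hT'T, hT'⟩ := Finset.exists_subset_card_eq hTcard
  let y := S.orderEmbOfFin hScard
  let x := T'.orderEmbOfFin hT'
  let b : Fin p → ℂ := fun u => w ^ (r₀ * (u + p * v u) : ℕ) * α u
  let e : Fin p → ℕ := fun u => (r₁ + (p ^ 2 - r₀)) * (u + p * v u) + p * t₁ * u
  have hr₀ : (r₀ : ℕ) ≤ p ^ 2 := r₀.2.le.trans (Nat.le_self_pow two_ne_zero p)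
  have hperiod : ∀ m k : ℕ, w ^ (m + p ^ 2 * k) = w ^ m := fun m k => by
    rw [pow_add, pow_mul, hw.pow_eq_one, one_pow, mul_one]
  have he : ∀ u, w ^ e u * b u = w ^ ((r₁ + p * t₁) * (u + p * v u) : ℕ) * α u := by
    intro u
    rw [← mul_assoc, ← pow_add, ← hperiod ((r₁ + p * t₁) * (u + p * v u))
      ((u + p * v u)), ← hperiod (e u + _) (t₁ * v u)]
    congr 2
    obtain ⟨k, hk⟩ := Nat.exists_eq_add_of_le hr₀
    simp only [e, show p ^ 2 - (r₀ : ℕ) = k by omega]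
    linear_combination (u + p * v u : ℕ) * hk.symm
  have hx : ∀ t u : Fin p, (w ^ p) ^ (t * u : ℕ) * b u =
      w ^ ((r₀ + p * t) * (u + p * v u) : ℕ) * α u := by
    intro t u
    rw [← mul_assoc, ← pow_mul, ← pow_add, ← hperiod _ (t * v u)]
    ring_nf
  have hb : (fun j => b (y j)) = 0 := by
    refine hw.eq_zero_of_sum_pow_eq_zero (x := fun i => (x i : ℕ)) (y := fun j => (y j : ℕ))
      (e := fun j => e (y j)) (Fin.val_injective.comp x.injective)
      (Fin.val_injective.comp y.injective) (fun i => (x i).2) (fun j => (y j).2) ?_ ?_ ?_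
    · intro i j hij
      apply y.injective
      have hij' : ((e (y i) : ℕ) : ZMod p) = (e (y j) : ℕ) :=
        (ZMod.natCast_eq_natCast_iff _ _ _).2 hij
      have hne : ((r₁ : ℕ) : ZMod p) - (r₀ : ℕ) ≠ 0 := by
        intro h
        rw [sub_eq_zero, ZMod.natCast_eq_natCast_iff', Nat.mod_eq_of_lt r₁.2,
          Nat.mod_eq_of_lt r₀.2] at h
        exact hr (Fin.ext h.symm)
      simp only [e] at hij'
      push_cast [hr₀] at hij'
      simp only [CharP.cast_eq_zero, zero_mul, add_zero, ne_eq, OfNat.ofNat_ne_zero,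
        not_false_eq_true, zero_pow, zero_sub, ← sub_eq_add_neg] at hij'
      have h := mul_left_cancel₀ hne hij'
      rw [ZMod.natCast_eq_natCast_iff', Nat.mod_eq_of_lt (y i).2, Nat.mod_eq_of_lt (y j).2] at h
      exact Fin.ext h
    · intro i
      simp only [hx]
      rw [S.sum_orderEmbOfFin hScard
        (fun u => w ^ ((r₀ + p * x i) * (u + p * v u) : ℕ) * α u)]
      exact hrestrict _ (hT _ (hT'T (Finset.orderEmbOfFin_mem _ _ _)))
    · simp only [he]
      rw [S.sum_orderEmbOfFin hScard
        (fun u => w ^ ((r₁ + p * t₁) * (u + p * v u) : ℕ) * α u)]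
      exact hrestrict _ h₁
  have hα := (hS (y 0)).1 (Finset.orderEmbOfFin_mem _ _ _)
  have h0 := congrFun hb 0
  simp only [Pi.zero_apply, b, mul_eq_zero, or_iff_left hα] at h0
  exact pow_ne_zero _ (hw.ne_zero (pow_ne_zero 2 hp.ne_zero)) h0

open Classical in
/-- Let `s` be the number of nonzero values of a nonzero function on `ℤ/p²ℤ` and `Z` the number of
zeros of its transform. Then `Z ≤ p * (s - 1)`, and `p * (s - 2) < Z < p * (s - 1)` is only
possible for `s = 2` and `Z = 1`. -/
theorem IsPrimitiveRoot.sum_card_zeros_le {p : ℕ} [Fact p.Prime] {w : ℂ}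
    (hw : IsPrimitiveRoot w (p ^ 2)) {a : Fin p → Fin p → ℂ} (ha : a ≠ 0) {s Z : ℕ}
    (hs : ∑ u, (Finset.univ.filter fun v => a u v ≠ 0).card = s)
    (hZ : ∑ r : Fin p, (Finset.univ.filter fun t : Fin p =>
      ∑ u : Fin p, ∑ v : Fin p, w ^ ((r + p * t) * (u + p * v) : ℕ) * a u v = 0).card = Z) :
    Z + p ≤ p * s ∧ ∀ q, s = q + 2 → q * p < Z → Z < (q + 1) * p → q = 0 ∧ Z = 1 := by
  have hp : p.Prime := Fact.out
  have hz : IsPrimitiveRoot (w ^ p) p := hw.pow (pow_pos hp.pos 2) (by ring)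
  have hw0 : w ≠ 0 := hw.ne_zero (pow_ne_zero 2 hp.ne_zero)
  let d : Fin p → Fin p → ℂ := fun u r => ∑ v : Fin p, (w ^ p) ^ (r * v : ℕ) * a u v
  let c : Fin p → Fin p → ℂ := fun r u => w ^ (r * u : ℕ) * d u r
  let zeros : Fin p → Finset (Fin p) := fun r =>
    {t | ∑ u : Fin p, (w ^ p) ^ (t * u : ℕ) * c r u = 0}
  have htrans : ∀ r t : Fin p,
      ∑ u : Fin p, ∑ v : Fin p, w ^ ((r + p * t) * (u + p * v) : ℕ) * a u v =
        ∑ u : Fin p, (w ^ p) ^ (t * u : ℕ) * c r u := by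
    intro r t
    refine Finset.sum_congr rfl fun u _ => ?_
    simp only [c, d, Finset.mul_sum]
    refine Finset.sum_congr rfl fun v _ => ?_
    have : w ^ ((r + p * t) * (u + p * v) : ℕ) =
        w ^ (p * (t * u) + (r * u + p * (r * v)) : ℕ) * (w ^ p ^ 2) ^ (t * v : ℕ) := by
      ring
    rw [this, hw.pow_eq_one]
    ring
  have hZ' : ∑ r, (zeros r).card = Z := by
    rw [← hZ]
    simp only [zeros, htrans]
  let U : Finset (Fin p) := {u | a u ≠ 0}
  let E : Finset (Fin p) := {r | c r = 0}
  let σ : Fin p → ℕ := fun u => (Finset.univ.filter fun v => a u v ≠ 0).card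
  have hU : 0 < U.card := by
    obtain ⟨u, hu⟩ := Function.ne_iff.1 ha
    exact Finset.card_pos.2 ⟨u, by simpa [U] using hu⟩
  have hσ : ∀ u ∈ U, E.card + 1 ≤ σ u := by
    intro u hu
    refine lt_of_le_of_lt (Finset.card_le_card fun r hr => ?_)
      (hz.card_zeros_lt_card_support (Finset.mem_filter.1 hu).2)
    have hcr : c r = 0 := by simpa [E] using hr
    simpa [c, hw0] using congrFun hcr u
  have hsU : ∑ u ∈ U, σ u = s := by
    rw [← hs]
    refine Finset.sum_subset (Finset.subset_univ U) fun u _ hu => ?_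
    have : a u = 0 := by simpa [U] using hu
    simp [σ, this]
  have hsE : U.card * (E.card + 1) ≤ s := by
    rw [← hsU, ← smul_eq_mul]
    exact Finset.card_nsmul_le_sum _ _ _ hσ
  have hzeros : ∀ r ∉ E, (zeros r).card + 1 ≤ U.card := by
    intro r hr
    have hcr : c r ≠ 0 := by simpa [E] using hr
    refine (hz.card_zeros_lt_card_support hcr).trans_le (Finset.card_le_card fun u hu => ?_)
    have hcru : c r u ≠ 0 := by simpa using hu
    simp only [U, Finset.mem_filter, Finset.mem_univ, true_and]
    intro hau
    simp [c, d, hau] at hcru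
  have hzerosE : ∀ r ∈ E, (zeros r).card = p := by
    intro r hr
    have hcr : c r = 0 := by simpa [E] using hr
    simp [zeros, hcr]
  have hsplit : E.card * p + ∑ r ∈ Eᶜ, (zeros r).card = Z := by
    rw [← hZ', ← Finset.sum_add_sum_compl E, Finset.sum_congr rfl hzerosE]
    simp
  have hcompl : E.card + Eᶜ.card = p := by simp
  obtain ⟨m, hm⟩ := Nat.exists_eq_succ_of_ne_zero hU.ne'
  have hsumle : ∑ r ∈ Eᶜ, (zeros r).card ≤ Eᶜ.card * m := by
    rw [← smul_eq_mul]
    refine Finset.sum_le_card_nsmul _ _ _ fun r hr => ?_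
    have := hzeros r (Finset.mem_compl.1 hr)
    omega
  have hsumle' : Eᶜ.card * m ≤ p * m := Nat.mul_le_mul_right _ (by omega)
  rw [hm] at hsE
  have hZle : Z ≤ p * (E.card + m) := by
    rw [mul_add, mul_comm p E.card]
    omega
  refine ⟨?_, ?_⟩
  · have : p * (E.card + m + 1) ≤ p * s := Nat.mul_le_mul_left _ (by nlinarith)
    linarith
  rintro q rfl hlow hhigh
  have hqlt : q < E.card + m := by
    by_contra! h
    have := Nat.mul_le_mul_left p h
    nlinarith
  have hEm : E.card * m < 1 := by
    have : (m + 1) * (E.card + 1) = E.card * m + E.card + m + 1 := by ring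
    rw [Nat.succ_eq_add_one] at hsE
    omega
  rcases Nat.mul_eq_zero.1 (Nat.lt_one_iff.1 hEm) with hE | rfl
  swap
  · have hZeq : Z = E.card * p := by omega
    rw [hZeq] at hlow hhigh
    have h1 := lt_of_mul_lt_mul_right hlow (Nat.zero_le p)
    have h2 := lt_of_mul_lt_mul_right hhigh (Nat.zero_le p)
    omega
  have hmq : m = q + 1 := by
    rw [hE] at hsE
    omega
  subst hmq
  have hEempty : E = ∅ := Finset.card_eq_zero.1 hE
  have hσ1 : ∀ u ∈ U, σ u = 1 := by
    have := (Finset.sum_eq_sum_iff_of_le (s := U) (f := fun _ => 1) (g := σ)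
      fun u hu => by have := hσ u hu; omega).1 (by rw [hsU]; simp [hm])
    exact fun u hu => (this u hu).symm
  have hv : ∀ u, ∃ v, ∀ v', v' ≠ v → a u v' = 0 := by
    intro u
    by_cases hu : u ∈ U
    · obtain ⟨v, hv⟩ := Finset.card_eq_one.1 (hσ1 u hu)
      refine ⟨v, fun v' hv' => ?_⟩
      by_contra h
      have : v' ∈ (Finset.univ.filter fun v => a u v ≠ 0) := by simpa using h
      rw [hv, Finset.mem_singleton] at this
      exact hv' this
    · have : a u = 0 := by simpa [U] using hu
      exact ⟨⟨0, hp.pos⟩, fun v' _ => by simp [this]⟩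
  choose v hv using hv
  have htrans' : ∀ r t : Fin p, ∑ u : Fin p, (w ^ p) ^ (t * u : ℕ) * c r u =
      ∑ u : Fin p, w ^ ((r + p * t) * (u + p * v u) : ℕ) * a u (v u) := by
    intro r t
    rw [← htrans]
    refine Finset.sum_congr rfl fun u _ => ?_
    exact Fintype.sum_eq_single _ fun v' hv' => by rw [hv u v' hv', mul_zero]
  obtain ⟨r₀, -, hr₀⟩ : ∃ r ∈ Finset.univ, q < (zeros r).card := by
    refine Finset.exists_lt_of_sum_lt ?_
    rw [hZ']
    simpa [mul_comm p q] using hlow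
  have hother : ∀ r ≠ r₀, (zeros r).card = 0 := by
    intro r hr
    rw [Finset.card_eq_zero, Finset.eq_empty_iff_forall_notMem]
    intro t ht
    refine hw.sum_ne_zero_of_card_zeros (α := fun u => a u (v u)) v (S := U) (T := zeros r₀)
      (t₁ := t) ?_ hm hr.symm hr₀ ?_ ?_
    · intro u
      have : a u = 0 ↔ a u (v u) = 0 := by
        refine ⟨fun h => by simp [h], fun h => funext fun v' => ?_⟩
        by_cases hv' : v' = v u
        · rw [hv', h, Pi.zero_apply]
        · exact hv u v' hv'
      simp [U, this]
    · intro t ht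
      rw [← htrans']
      simpa [zeros] using ht
    · rw [← htrans']
      simpa [zeros] using ht
  have hZr₀ : Z = (zeros r₀).card := by
    rw [← hZ', Fintype.sum_eq_single r₀ hother]
  have := hzeros r₀ (by simp [hEempty])
  have := Nat.mul_le_mul_left q hp.two_le
  omega

/-- The Fourier transform in terms of powers of a primitive root of unity. -/
theorem zdft_apply_eq_sum_pow (n : ℕ) [NeZero n] (f : ZMod n → ℂ) (y : ZMod n) :
    zdft n f y = ∑ x, (Complex.exp (2 * Real.pi * Complex.I / n))⁻¹ ^ (x.val * y.val) * f x := by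
  refine Finset.sum_congr rfl fun x _ => ?_
  rw [mul_comm, ← Complex.exp_neg, ← Complex.exp_nat_mul]
  congr 2
  ring

theorem zdft_eq_dft (n : ℕ) [NeZero n] (f : ZMod n → ℂ) : zdft n f = ZMod.dft f := by
  ext y
  rw [ZMod.dft_apply]
  refine Finset.sum_congr rfl fun x _ => ?_
  have h : -(x * y) = ((-(x.val * y.val : ℕ) : ℤ) : ZMod n) := by simp
  rw [h, ZMod.stdAddChar_coe, smul_eq_mul, mul_comm]
  congr 2
  push_cast
  ring

theorem zdft_ne_zero {n : ℕ} [NeZero n] {f : ZMod n → ℂ} (hf : f ≠ 0) : zdft n f ≠ 0 := by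
  rw [zdft_eq_dft]
  exact (map_ne_zero_iff _ (ZMod.dft (N := n) (E := ℂ)).injective).2 hf

theorem ncard_support_zdft_zdft (n : ℕ) [NeZero n] (f : ZMod n → ℂ) :
    (support (zdft n (zdft n f))).ncard = (support f).ncard := by
  have h : support (zdft n (zdft n f)) = Neg.neg ⁻¹' support f := by
    ext x
    rw [zdft_eq_dft, zdft_eq_dft, ZMod.dft_dft]
    simp [NeZero.ne n]
  rw [h]
  exact Set.ncard_preimage_of_injective_subset_range neg_injective (by simp)

theorem digits_lt_sq {p : ℕ} (v u : Fin p) : (u + p * v : ℕ) < p ^ 2 := by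
  rw [sq]
  exact (finProdFinEquiv (v, u)).2

/-- `ℤ/p²ℤ` is parametrized by the digits in base `p`, the higher digit coming first. -/
noncomputable def digitsEquiv (p : ℕ) [Fact p.Prime] : Fin p × Fin p ≃ ZMod (p ^ 2) :=
  Equiv.ofBijective (fun d => ((d.2 + p * d.1 : ℕ) : ZMod (p ^ 2))) <| by
    rw [Fintype.bijective_iff_injective_and_card]
    refine ⟨fun d d' h => ?_, by simp [sq]⟩
    rw [ZMod.natCast_eq_natCast_iff', Nat.mod_eq_of_lt (digits_lt_sq _ _),
      Nat.mod_eq_of_lt (digits_lt_sq _ _)] at h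
    exact finProdFinEquiv.injective (Fin.ext h)

theorem val_digitsEquiv (p : ℕ) [Fact p.Prime] (v u : Fin p) :
    (digitsEquiv p (v, u)).val = u + p * v :=
  ZMod.val_natCast_of_lt (digits_lt_sq v u)

theorem zdft_digitsEquiv (p : ℕ) [Fact p.Prime] (f : ZMod (p ^ 2) → ℂ) (t r : Fin p) :
    zdft (p ^ 2) f (digitsEquiv p (t, r)) = ∑ u : Fin p, ∑ v : Fin p,
      (Complex.exp (2 * Real.pi * Complex.I / (p ^ 2 : ℕ)))⁻¹ ^ ((r + p * t) * (u + p * v) : ℕ) *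
        f (digitsEquiv p (v, u)) := by
  rw [zdft_apply_eq_sum_pow, ← (digitsEquiv p).sum_comp, Fintype.sum_prod_type_right]
  simp only [val_digitsEquiv]
  refine Finset.sum_congr rfl fun u _ => Finset.sum_congr rfl fun v _ => ?_
  rw [mul_comm (_ + _)]

open Classical in
theorem ncard_setOf_eq_sum_digits (p : ℕ) [Fact p.Prime] (P : ZMod (p ^ 2) → Prop) :
    {x | P x}.ncard =
      ∑ u : Fin p, (Finset.univ.filter fun v : Fin p => P (digitsEquiv p (v, u))).card := by
  rw [← Finset.coe_filter_univ, Set.ncard_coe_finset]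
  simp only [Finset.card_filter]
  rw [← (digitsEquiv p).sum_comp, Fintype.sum_prod_type_right]

theorem ncard_zeros_add_ncard_support {n : ℕ} [NeZero n] (f : ZMod n → ℂ) :
    {x | f x = 0}.ncard + (support f).ncard = n := by
  have h : support f = {x | f x = 0}ᶜ := rfl
  rw [h, Set.ncard_add_ncard_compl, Nat.card_zmod]

/-- Meshulam's inequality on `ℤ/p²ℤ`, together with a gap in the sizes of the spectrum. -/
theorem le_ncard_support_zdft {p : ℕ} [Fact p.Prime] {f : ZMod (p ^ 2) → ℂ} (hf : f ≠ 0) :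
    p ^ 2 + p ≤ (support (zdft (p ^ 2) f)).ncard + p * (support f).ncard ∧
    ∀ q, (support f).ncard = q + 2 → q * p + (support (zdft (p ^ 2) f)).ncard < p ^ 2 →
      p ^ 2 < (q + 1) * p + (support (zdft (p ^ 2) f)).ncard →
      (support (zdft (p ^ 2) f)).ncard + 1 = p ^ 2 := by
  classical
  have hw := (Complex.isPrimitiveRoot_exp (p ^ 2) (NeZero.ne _)).inv
  have ha : (fun u v => f (digitsEquiv p (v, u))) ≠ 0 := by
    obtain ⟨x, hx⟩ := Function.ne_iff.1 hf
    intro h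
    apply hx
    simpa using congrFun (congrFun h ((digitsEquiv p).symm x).2) ((digitsEquiv p).symm x).1
  have hs := ncard_setOf_eq_sum_digits p fun x => f x ≠ 0
  have hZ := ncard_setOf_eq_sum_digits p fun x => zdft (p ^ 2) f x = 0
  simp only [zdft_digitsEquiv] at hZ
  have hcard := ncard_zeros_add_ncard_support (zdft (p ^ 2) f)
  obtain ⟨h1, h2⟩ := hw.sum_card_zeros_le (s := (support f).ncard) ha
    (Eq.trans (by congr!) hs.symm) hZ.symm
  refine ⟨by omega, fun q hq hlow hhigh => ?_⟩
  obtain ⟨-, hZ1⟩ := h2 q hq (by omega) (by omega)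
  omega

/-- Functions on the subgroup of order `p` attaining Meshulam's bound. -/
theorem exists_ncard_support_le {p : ℕ} [Fact p.Prime] {m : ℕ} (hm : m < p) :
    ∃ f : ZMod (p ^ 2) → ℂ, f ≠ 0 ∧ (support f).ncard ≤ m + 1 ∧
      (support (zdft (p ^ 2) f)).ncard + p * m ≤ p ^ 2 := by
  classical
  have hp : p.Prime := Fact.out
  set w := (Complex.exp (2 * Real.pi * Complex.I / (p ^ 2 : ℕ)))⁻¹ with hw
  let P : Polynomial ℂ := ∏ j ∈ Finset.range m, (Polynomial.X - Polynomial.C ((w ^ p) ^ j))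
  have hdeg : P.natDegree = m := by simp [P, -map_pow]
  have hPmonic : P.Monic := Polynomial.monic_prod_X_sub_C _ _
  let f : ZMod (p ^ 2) → ℂ := fun x =>
    if (((digitsEquiv p).symm x).2 : ℕ) = 0 then P.coeff ((digitsEquiv p).symm x).1 else 0
  have hfe : ∀ u v, f (digitsEquiv p (v, u)) = if (u : ℕ) = 0 then P.coeff v else 0 := by
    intro u v
    simp [f]
  refine ⟨f, ?_, ?_, ?_⟩
  · intro h
    have h0 := hfe ⟨0, hp.pos⟩ ⟨m, hm⟩
    rw [h, if_pos rfl, Pi.zero_apply] at h0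
    have := hPmonic.coeff_natDegree
    rw [hdeg, ← h0] at this
    exact zero_ne_one this
  · have hs := ncard_setOf_eq_sum_digits p fun x => f x ≠ 0
    change (support f).ncard = _ at hs
    rw [hs, Fintype.sum_eq_single ⟨0, hp.pos⟩]
    · refine (Finset.card_le_card_of_injOn (t := Finset.range (m + 1)) (fun v : Fin p => (v : ℕ))
        ?_ Fin.val_injective.injOn).trans (by simp)
      intro v hv
      simp only [hfe, Finset.coe_filter, Finset.mem_univ, true_and, Set.mem_ofPred_eq, if_pos] at hv
      have := Polynomial.le_natDegree_of_ne_zero hv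
      simp
      omega
    · intro u hu
      have : (u : ℕ) ≠ 0 := fun h => hu (Fin.ext h)
      simp [hfe, this]
  · have hZ := ncard_setOf_eq_sum_digits p fun x => zdft (p ^ 2) f x = 0
    have hcard := ncard_zeros_add_ncard_support (zdft (p ^ 2) f)
    have heval : ∀ r t : Fin p,
        zdft (p ^ 2) f (digitsEquiv p (t, r)) = P.eval ((w ^ p) ^ (r : ℕ)) := by
      intro r t
      rw [zdft_digitsEquiv, Fintype.sum_eq_single ⟨0, hp.pos⟩]
      · rw [Polynomial.eval_eq_sum_range' (hdeg.trans_lt hm), ← Fin.sum_univ_eq_sum_range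
          (fun i => P.coeff i * ((w ^ p) ^ (r : ℕ)) ^ i)]
        refine Finset.sum_congr rfl fun v _ => ?_
        have hwp : (w ^ p ^ 2) = 1 :=
          (Complex.isPrimitiveRoot_exp (p ^ 2) (NeZero.ne _)).inv.pow_eq_one
        have : w ^ ((r + p * t) * (0 + p * v) : ℕ) =
            ((w ^ p) ^ (r : ℕ)) ^ (v : ℕ) * (w ^ p ^ 2) ^ (t * v : ℕ) := by
          ring
        rw [hfe, if_pos rfl, ← hw, this, hwp, one_pow, mul_one, mul_comm]
      · intro u hu
        have : (u : ℕ) ≠ 0 := fun h => hu (Fin.ext h)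
        simp [hfe, this]
    have hle : p * m ≤ {x | zdft (p ^ 2) f x = 0}.ncard := by
      rw [hZ]
      have hroot : ∀ r ∈ Finset.univ.filter (fun r : Fin p => (r : ℕ) < m), p ≤
          (Finset.univ.filter fun t : Fin p => zdft (p ^ 2) f (digitsEquiv p (t, r)) = 0).card := by
        intro r hr
        have h0 : P.eval ((w ^ p) ^ (r : ℕ)) = 0 := by
          rw [Polynomial.eval_prod]
          exact Finset.prod_eq_zero (i := (r : ℕ)) (by simpa using hr) (by simp)
        simp [heval, h0]
      have hcardm : (Finset.univ.filter (fun r : Fin p => (r : ℕ) < m)).card = m := by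
        rw [Fin.card_filter_val_lt, min_eq_right hm.le]
      refine le_trans ?_ (Finset.sum_le_sum_of_subset
        (Finset.filter_subset (fun r : Fin p => (r : ℕ) < m) _))
      have := Finset.card_nsmul_le_sum _ _ _ hroot
      rwa [hcardm, smul_eq_mul, mul_comm] at this
    omega

theorem ztheta_eq_of_le {n : ℕ} [NeZero n] {k l : ℕ}
    (hle : ∃ f : ZMod n → ℂ, f ≠ 0 ∧ (support f).ncard ≤ k ∧ (support (zdft n f)).ncard ≤ l)
    (hge : ∀ f : ZMod n → ℂ, f ≠ 0 → (support f).ncard ≤ k → l ≤ (support (zdft n f)).ncard) :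
    ztheta n k = l := by
  obtain ⟨f, hf, hk, hl⟩ := hle
  apply le_antisymm
  · exact le_trans (Nat.sInf_le ⟨f, hf, hk, rfl⟩) hl
  · have hne : {l | ∃ f : ZMod n → ℂ, f ≠ 0 ∧ (support f).ncard ≤ k ∧
        (support (zdft n f)).ncard = l}.Nonempty := ⟨_, f, hf, hk, rfl⟩
    refine le_csInf hne ?_
    rintro _ ⟨g, hg, hgk, rfl⟩
    exact hge g hg hgk

theorem exists_isZEqualityCase_of_ztheta_lt {n : ℕ} [NeZero n] {k : ℕ} (hk : k ≠ 0)
    (hlt : ztheta n k < ztheta n (k - 1)) : ∃ f : ZMod n → ℂ, IsZEqualityCase n k f := by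
  have hne : {l | ∃ f : ZMod n → ℂ, f ≠ 0 ∧ (support f).ncard ≤ k ∧
      (support (zdft n f)).ncard = l}.Nonempty := by
    refine ⟨_, Pi.single 0 1, by simp, ?_, rfl⟩
    refine (Set.ncard_le_ncard
      (Pi.support_single_subset (i := (0 : ZMod n)) (a := (1 : ℂ)))).trans ?_
    rw [Set.ncard_singleton]
    omega
  obtain ⟨f, hf, hfk, hfl⟩ := Nat.sInf_mem hne
  refine ⟨f, hf, ?_, hfl⟩
  by_contra hcard
  have : ztheta n (k - 1) ≤ ztheta n k := Nat.sInf_le ⟨f, hf, by omega, hfl⟩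
  omega

theorem ztheta_sq_of_le {p : ℕ} [Fact p.Prime] {k : ℕ} (hk : 1 ≤ k) (hkp : k ≤ p) :
    ztheta (p ^ 2) k = p * (p - k + 1) := by
  obtain ⟨m, rfl⟩ := Nat.exists_eq_add_of_le' hk
  obtain ⟨j, rfl⟩ := Nat.exists_eq_add_of_le hkp
  rw [Nat.add_sub_cancel_left]
  refine ztheta_eq_of_le ?_ fun f hf hfk => ?_
  · obtain ⟨f, hf, h1, h2⟩ := exists_ncard_support_le (p := m + 1 + j) (m := m) (by omega)
    exact ⟨f, hf, h1, by nlinarith⟩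
  · have h1 := (le_ncard_support_zdft hf).1
    have h2 := Nat.mul_le_mul_left (m + 1 + j) hfk
    nlinarith

theorem ztheta_sq_of_ge {p : ℕ} [Fact p.Prime] {k : ℕ} (hk : p ≤ k) (hkp : k ≤ p ^ 2) :
    ztheta (p ^ 2) k = p - k / p + 1 := by
  have hp : p.Prime := Fact.out
  have hj1 : 1 ≤ k / p := (Nat.one_le_div_iff hp.pos).2 hk
  have hjp : k / p ≤ p := Nat.div_le_of_le_mul (by rwa [← sq])
  have hdiv := Nat.div_add_mod k p
  have hmod := Nat.mod_lt k hp.pos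
  generalize k / p = j at *
  obtain ⟨i, hi⟩ := Nat.exists_eq_add_of_le hjp
  have hsq : p ^ 2 = p * j + p * i := by rw [← mul_add, ← hi, sq]
  rw [show p - j = i by omega]
  refine ztheta_eq_of_le ?_ fun f hf hfk => ?_
  · obtain ⟨f, hf, h1, h2⟩ := exists_ncard_support_le (p := p) (m := i) (by omega)
    refine ⟨zdft (p ^ 2) f, zdft_ne_zero hf, by omega, ?_⟩
    rwa [ncard_support_zdft_zdft]
  · have h1 := (le_ncard_support_zdft (zdft_ne_zero hf)).1
    rw [ncard_support_zdft_zdft] at h1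
    by_contra! hlt
    have h2 := Nat.mul_le_mul_left p (Nat.le_of_lt_succ hlt)
    omega

/-- Two exponentials at consecutive frequencies cancel at one point only. -/
theorem exists_ncard_support_eq_sub_one {n : ℕ} [NeZero n] (hn : 1 < n) :
    ∃ f : ZMod n → ℂ, f ≠ 0 ∧ (support f).ncard = n - 1 ∧ (support (zdft n f)).ncard = 2 := by
  have : Fact (1 < n) := ⟨hn⟩
  let f : ZMod n → ℂ := Pi.single 0 1 - Pi.single 1 1
  have hsupp : support f = {0, 1} := by
    ext x
    by_cases h0 : x = 0
    · simp [f, h0]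
    · by_cases h1 : x = 1 <;> simp [f, h0, h1]
  have hf : f ≠ 0 := by
    rw [← support_nonempty_iff, hsupp]
    exact Set.insert_nonempty _ _
  refine ⟨zdft n f, zdft_ne_zero hf, ?_, ?_⟩
  · have hw := (Complex.isPrimitiveRoot_exp n (NeZero.ne n)).inv
    have hzero : {y | zdft n f y = 0} = {0} := by
      ext y
      have heval : zdft n f y = 1 - (Complex.exp (2 * Real.pi * Complex.I / n))⁻¹ ^ y.val := by
        rw [zdft_apply_eq_sum_pow]
        simp [f, mul_sub, Finset.sum_sub_distrib, Pi.single_apply, ZMod.val_one]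
      rw [Set.mem_ofPred_eq, heval, sub_eq_zero, eq_comm, Set.mem_singleton_iff,
        hw.pow_eq_one_iff_dvd]
      refine ⟨fun h => ?_, fun h => by simp [h]⟩
      rw [← ZMod.val_eq_zero]
      exact Nat.eq_zero_of_dvd_of_lt h y.val_lt
    have := ncard_zeros_add_ncard_support (zdft n f)
    rw [hzero, Set.ncard_singleton] at this
    omega
  · rw [ncard_support_zdft_zdft, hsupp, Set.ncard_pair zero_ne_one]

/-- Meshulam's function for `G = ℤ/p²ℤ`, `p` prime (`⌊k/p⌋` is natural division), together
with the characterization of the `k` with equality cases: they exist iff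
`θ(k, G) < θ(k-1, G)` or `k = p² - 1`. -/
theorem theta_p_squared (p : ℕ) [Fact p.Prime] :
    (∀ k : ℕ, 1 ≤ k → k ≤ p →
      ztheta (p ^ 2) k = p * (p - k + 1)) ∧
    (∀ k : ℕ, p ≤ k → k ≤ p ^ 2 →
      ztheta (p ^ 2) k = p - k / p + 1) ∧
    (∀ k : ℕ, 2 ≤ k → k ≤ p ^ 2 →
      ((∃ f : ZMod (p ^ 2) → ℂ, IsZEqualityCase (p ^ 2) k f) ↔
        (ztheta (p ^ 2) k < ztheta (p ^ 2) (k - 1) ∨ k = p ^ 2 - 1))) := by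
  have hp : p.Prime := Fact.out
  refine ⟨fun k hk hkp => ztheta_sq_of_le hk hkp, fun k hk hkp => ztheta_sq_of_ge hk hkp,
    fun k hk2 hk => ⟨?_, ?_⟩⟩
  · rintro ⟨f, hf, hfk, hfl⟩
    rcases le_or_gt k p with hkp | hkp
    · left
      rw [ztheta_sq_of_le (by omega) hkp, ztheta_sq_of_le (by omega) (by omega)]
      exact Nat.mul_lt_mul_of_pos_left (by omega) hp.pos
    rw [ztheta_sq_of_ge hkp.le hk] at hfl ⊢
    rw [ztheta_sq_of_ge (by omega) (by omega)]
    have hjp : k / p ≤ p := Nat.div_le_of_le_mul (by rwa [← sq])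
    have hdiv := Nat.div_add_mod k p
    have hmod := Nat.mod_lt k hp.pos
    rcases Nat.eq_zero_or_pos (k % p) with h0 | hpos
    · left
      have : (k - 1) / p < k / p := by
        rw [Nat.div_lt_iff_lt_mul hp.pos, mul_comm]
        omega
      omega
    · right
      generalize k / p = j at *
      obtain ⟨i, hi⟩ := Nat.exists_eq_add_of_le hjp
      have hsq : p ^ 2 = p * j + p * i := by rw [← mul_add, ← hi, sq]
      rcases i with _ | q
      · omega
      have hgap := (le_ncard_support_zdft (zdft_ne_zero hf)).2 q (by omega)
      rw [ncard_support_zdft_zdft, hfk, mul_comm q, mul_comm (q + 1)] at hgap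
      have := hgap (by rw [mul_add, mul_one] at hsq; omega) (by omega)
      omega
  · rintro (hlt | rfl)
    · exact exists_isZEqualityCase_of_ztheta_lt (by omega) hlt
    · have hsq : p ^ 2 = p * p := sq p
      have h2 := Nat.mul_le_mul_left p hp.two_le
      obtain ⟨f, hf, h1, h3⟩ := exists_ncard_support_eq_sub_one (n := p ^ 2) (by omega)
      refine ⟨f, hf, h1, ?_⟩
      rw [h3, ztheta_sq_of_ge (by omega) (by omega)]
      have : (p ^ 2 - 1) / p = p - 1 := by
        obtain ⟨j, rfl⟩ := Nat.exists_eq_add_of_le' hp.one_le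
        rw [show (j + 1) ^ 2 - 1 = j + (j + 1) * j by rw [Nat.sub_eq_iff_eq_add (by omega)]; ring,
          Nat.add_mul_div_left _ _ (Nat.succ_pos j), Nat.div_eq_of_lt (Nat.lt_succ_self j)]
        omega
      have := hp.one_lt
      omega
end

section
/- Let p be a prime number, G = ℤ/p²ℤ, H = {pj : j = 0, 1, …, p-1} the subgroup of order p, and 1 ≤ k ≤ p. Then every equality case for (k, G) is of the form f(a + px) = g(x) for x = 0, …, p-1 and f = 0 outside the coset a + H, where a ∈ {0, …, p-1} and g : ℤ/pℤ → ℂ satisfies |supp(g)| = k and |supp(ĝ)| = p - k + 1. -/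
open Function

namespace Polynomial

/-- Over a field of characteristic `p`, a polynomial of degree less than `p` with at most `n` terms
that vanishes at `1` to order at least `n` is zero. -/
theorem eq_zero_of_X_sub_one_pow_dvd_s18 {F : Type*} [Field F] {p : ℕ} [CharP F p] {n : ℕ} {P : F[X]}
    (hdeg : P.natDegree < p) (hcard : P.support.card ≤ n) (hdvd : (X - 1) ^ n ∣ P) : P = 0 := by
  induction n generalizing P with
  | zero => simpa using hcard
  | succ n ih =>
    by_contra hP
    obtain ⟨r, hr⟩ := nonempty_support_iff.mpr hP
    have hcoeff (i : ℕ) : (X * derivative P - C (r : F) * P).coeff i = ((i : F) - r) * P.coeff i := by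
      cases i with
      | zero => simp
      | succ i => simp [coeff_X_mul, coeff_derivative]; ring
    have hsupp : (X * derivative P - C (r : F) * P).support ⊆ P.support.erase r := by
      intro i hi
      rw [mem_support_iff, hcoeff] at hi
      rw [Finset.mem_erase, mem_support_iff]
      refine ⟨?_, right_ne_zero_of_mul hi⟩
      rintro rfl
      simp at hi
    have hzero : X * derivative P - C (r : F) * P = 0 := by
      refine ih (lt_of_le_of_lt ?_ hdeg) ?_ ?_
      · rw [natDegree_le_iff_coeff_eq_zero]
        intro N hN
        rw [hcoeff, coeff_eq_zero_of_natDegree_lt hN, mul_zero]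
      · have := Finset.card_le_card hsupp
        rw [Finset.card_erase_of_mem hr] at this
        omega
      · have h := pow_sub_one_dvd_derivative_of_pow_dvd hdvd
        exact dvd_sub (h.mul_left _) (((pow_dvd_pow _ n.le_succ).trans hdvd).mul_left _)
    have hmon : P = monomial r (P.coeff r) := by
      ext i
      rw [coeff_monomial]
      split_ifs with h
      · rw [h]
      · by_contra hne
        have h0 := hcoeff i
        rw [hzero, coeff_zero, eq_comm, mul_eq_zero, sub_eq_zero] at h0
        exact h (CharP.natCast_injOn_Iio F p (lt_of_le_of_lt (le_natDegree_of_mem_supp r hr) hdeg)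
          (lt_of_le_of_lt (le_natDegree_of_ne_zero hne) hdeg) (h0.resolve_right hne).symm)
    have hroot : P.eval 1 = 0 := by
      have : (X - C 1 : F[X]) ∣ P := by
        simpa using (dvd_pow_self _ n.succ_ne_zero).trans hdvd
      exact dvd_iff_isRoot.mp this
    rw [hmon, eval_monomial] at hroot
    simp only [one_pow, mul_one] at hroot
    exact mem_support_iff.mp hr hroot

end Polynomial

/-- The primitive `n`-th root of unity occurring as the basic character value in `zdft`. -/
noncomputable def zroot (n : ℕ) : ℂ := Complex.exp (-2 * Real.pi * Complex.I / n)

theorem isPrimitiveRoot_zroot (n : ℕ) [NeZero n] : IsPrimitiveRoot (zroot n) n := by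
  have h := (Complex.isPrimitiveRoot_exp n (NeZero.ne n)).inv
  rw [← Complex.exp_neg] at h
  rwa [show -(2 * Real.pi * Complex.I / (n : ℂ)) = -2 * Real.pi * Complex.I / n by ring] at h

theorem zdft_apply (n : ℕ) [NeZero n] (f : ZMod n → ℂ) (y : ZMod n) :
    zdft n f y = ∑ x : ZMod n, f x * zroot n ^ (x.val * y.val) := by
  refine Finset.sum_congr rfl fun x _ => ?_
  rw [zroot, ← Complex.exp_nat_mul]
  congr 2
  ring

theorem exists_valuationSubring_residue_charP (K : Type*) [Field K] [CharZero K] (p : ℕ)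
    [Fact p.Prime] : ∃ O : ValuationSubring K, CharP (IsLocalRing.ResidueField O) p := by
  let A : Subring K := (Int.castRingHom K).range
  let P : A := ⟨p, p, by simp⟩
  have hI : Ideal.span {P} ≠ ⊤ := by
    rw [Ne, Ideal.span_singleton_eq_top, isUnit_iff_exists_inv]
    rintro ⟨⟨_, n, rfl⟩, hn⟩
    have h : (p : K) * n = 1 := by simpa [P] using congrArg Subtype.val hn
    have h' : (p : ℤ) * n = 1 := by exact_mod_cast h
    have := Int.isUnit_iff_natAbs_eq.mp (IsUnit.of_mul_eq_one n h')
    exact (Fact.out : p.Prime).one_lt.ne' (by simpa using this)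
  obtain ⟨O, -, hO⟩ := Ideal.image_subset_nonunits_valuationSubring _ hI
  refine ⟨O, ?_⟩
  have hp : (p : K) ∈ O.nonunits := hO ⟨P, Ideal.mem_span_singleton_self P, rfl⟩
  have hmem : (p : O) ∈ IsLocalRing.maximalIdeal O := by
    rw [ValuationSubring.valuation_lt_one_iff]
    simpa [ValuationSubring.mem_nonunits_iff] using hp
  have hzero : (p : IsLocalRing.ResidueField O) = 0 := by
    rw [← map_natCast (IsLocalRing.residue O), IsLocalRing.residue_eq_zero_iff]
    exact hmem
  exact (CharP.charP_iff_prime_eq_zero Fact.out).mpr hzero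

/-- The uncertainty principle for `ℤ/pℤ`: a function supported on `A` whose Fourier transform
vanishes on a set with at least as many elements as `A` is zero. -/
theorem eq_zero_of_zdft_eq_zero {p : ℕ} [Fact p.Prime] {g : ZMod p → ℂ} {A Z : Finset (ZMod p)}
    (hA : ∀ a ∉ A, g a = 0) (hZ : ∀ z ∈ Z, zdft p g z = 0) (hcard : A.card ≤ Z.card) : g = 0 := by
  classical
  by_contra hg
  obtain ⟨O, hO⟩ := exists_valuationSubring_residue_charP ℂ p
  obtain ⟨b, -, hb⟩ := Finset.exists_max_image Finset.univ (fun a => O.valuation (g a))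
    Finset.univ_nonempty
  have hgb : g b ≠ 0 := by
    intro h
    refine hg (funext fun a => ?_)
    have := hb a (Finset.mem_univ a)
    rw [h, map_zero, le_zero_iff, map_eq_zero] at this
    exact this
  choose G hG using fun a => (O.valuation_le_iff (g a) (g b)).mp (hb a (Finset.mem_univ a))
  have hGb : G b = 1 := by
    have := mul_right_cancel₀ hgb ((hG b).trans (one_mul _).symm)
    exact_mod_cast this
  have hroot := isPrimitiveRoot_zroot p
  have hζ : zroot p ∈ O := by
    rw [← ValuationSubring.valuation_le_one_iff, ← pow_le_one_iff (Fact.out : p.Prime).ne_zero,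
      ← map_pow, hroot.pow_eq_one, map_one]
  let ζ : O := ⟨zroot p, hζ⟩
  have hζO : IsPrimitiveRoot ζ p := IsPrimitiveRoot.of_map_of_injective (f := O.subtype)
    hroot O.subtype_injective
  let P : Polynomial O := ∑ a : ZMod p, Polynomial.monomial a.val (G a)
  have hcoeff (a : ZMod p) : P.coeff a.val = G a := by
    simp [P, Polynomial.coeff_monomial, (ZMod.val_injective p).eq_iff]
  have hdeg : P.natDegree < p := by
    refine lt_of_le_of_lt (b := p - 1) (Polynomial.natDegree_sum_le_of_forall_le _ _ fun a _ => ?_)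
      (Nat.sub_lt (Fact.out : p.Prime).pos one_pos)
    exact (Polynomial.natDegree_monomial_le _).trans (Nat.le_pred_of_lt a.val_lt)
  have hP : P ≠ 0 := by
    intro h
    have := hcoeff b
    rw [h, hGb] at this
    simp at this
  have heval (z : ZMod p) (hz : z ∈ Z) : P.eval (ζ ^ z.val) = 0 := by
    apply O.subtype_injective
    apply mul_right_cancel₀ hgb
    rw [map_zero, zero_mul, ← hZ z hz, zdft_apply, Polynomial.eval_finsetSum, map_sum,
      Finset.sum_mul]
    refine Finset.sum_congr rfl fun a _ => ?_
    rw [← hG a]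
    simp [ζ, ← pow_mul, mul_comm a.val]
    ring
  let s : Multiset O := Z.val.map fun z => ζ ^ z.val
  have hs : s.Nodup := Multiset.Nodup.map_on (fun x _ y _ h =>
    ZMod.val_injective p (hζO.pow_inj x.val_lt y.val_lt h)) Z.nodup
  have hdvd : (s.map fun a => Polynomial.X - Polynomial.C a).prod ∣ P := by
    rw [Multiset.prod_X_sub_C_dvd_iff_le_roots hP, Multiset.le_iff_subset hs]
    intro x hx
    obtain ⟨z, hz, rfl⟩ := Multiset.mem_map.mp hx
    exact (Polynomial.mem_roots hP).mpr (heval z hz)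
  let φ := IsLocalRing.residue O
  have hφζ : φ ζ = 1 := by
    have : ExpChar (IsLocalRing.ResidueField O) p := .prime Fact.out
    apply frobenius_inj (IsLocalRing.ResidueField O) p
    rw [frobenius_def, frobenius_def, ← map_pow, hζO.pow_eq_one, map_one, one_pow]
  have hdvd' : (Polynomial.X - 1) ^ Z.card ∣ P.map φ := by
    have := Polynomial.map_dvd φ hdvd
    rw [Polynomial.map_multiset_prod, Multiset.map_map] at this
    simpa [s, Function.comp_def, hφζ] using this
  have hsupp : (P.map φ).support ⊆ A.image ZMod.val := by
    intro i hi
    rw [Polynomial.mem_support_iff, Polynomial.coeff_map] at hi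
    have hi' : P.coeff i ≠ 0 := fun h => hi (by rw [h, map_zero])
    have hip : i < p := (Polynomial.le_natDegree_of_ne_zero hi').trans_lt hdeg
    refine Finset.mem_image.mpr ⟨(i : ZMod p), ?_, ZMod.val_cast_of_lt hip⟩
    by_contra hiA
    apply hi'
    have h := hcoeff (i : ZMod p)
    rw [ZMod.val_cast_of_lt hip] at h
    rw [h]
    have h0 := hG (i : ZMod p)
    rw [hA _ hiA, mul_eq_zero] at h0
    exact_mod_cast h0.resolve_right hgb
  have hzero := Polynomial.eq_zero_of_X_sub_one_pow_dvd_s18 (p := p)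
    (Polynomial.natDegree_map_le.trans_lt hdeg)
    (((Finset.card_le_card hsupp).trans Finset.card_image_le).trans hcard) hdvd'
  have h1 := congrArg (fun Q => Polynomial.coeff Q b.val) hzero
  simp [Polynomial.coeff_map, hcoeff, hGb] at h1

theorem zroot_sq_pow (p : ℕ) [NeZero p] : zroot (p ^ 2) ^ p = zroot p := by
  have hp : (p : ℂ) ≠ 0 := Nat.cast_ne_zero.mpr (NeZero.ne p)
  rw [zroot, zroot, ← Complex.exp_nat_mul]
  congr 1
  push_cast
  field_simp

/-- The support of a function on a finite type, counted by an indicator sum. -/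
theorem ncard_support_eq_sum {α : Type*} [Fintype α] (f : α → ℂ) :
    (support f).ncard = ∑ x, (support f).indicator 1 x := by
  classical
  rw [Set.ncard_eq_toFinset_card', Finset.card_eq_sum_ones, ← Finset.sum_subset
    (Finset.subset_univ (support f).toFinset)]
  · exact Finset.sum_congr rfl fun x hx => by simp_all
  · intro x _ hx
    simp_all

theorem add_one_le_ncard_support_add {p : ℕ} [Fact p.Prime] {g : ZMod p → ℂ} (hg : g ≠ 0) :
    p + 1 ≤ (support g).ncard + (support (zdft p g)).ncard := by
  classical
  by_contra! h
  refine hg (eq_zero_of_zdft_eq_zero (A := (support g).toFinset)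
    (Z := (support (zdft p g)).toFinsetᶜ) (by simp) (by simp) ?_)
  rw [Finset.card_compl, ZMod.card, ← Set.ncard_eq_toFinset_card', ← Set.ncard_eq_toFinset_card']
  omega

theorem zdft_eq_of_eq_zero {n : ℕ} [NeZero n] {g : ZMod n → ℂ} {a : ZMod n}
    (h : ∀ x, x ≠ a → g x = 0) (y : ZMod n) :
    zdft n g y = g a * zroot n ^ (a.val * y.val) := by
  rw [zdft_apply]
  exact Fintype.sum_eq_single a fun x hx => by rw [h x hx, zero_mul]

open IntermediateField in
/-- A homogeneous system of fewer Fourier conditions than unknowns has a nonzero solution over the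
cyclotomic field. -/
theorem exists_ne_zero_zdft_eq_zero {p : ℕ} [NeZero p] {A Z : Finset (ZMod p)}
    (hcard : Z.card < A.card) :
    ∃ u : ZMod p → ℂ, u ≠ 0 ∧ (∀ a, u a ∈ ℚ⟮zroot p⟯) ∧ (∀ a ∉ A, u a = 0) ∧
      ∀ z ∈ Z, zdft p u z = 0 := by
  classical
  let M : Matrix Z A ℚ⟮zroot p⟯ :=
    fun z a => AdjoinSimple.gen ℚ (zroot p) ^ (a.1.val * z.1.val)
  have hker : LinearMap.ker M.mulVecLin ≠ ⊥ :=
    LinearMap.ker_ne_bot_of_finrank_lt (by simpa using hcard)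
  obtain ⟨v, hv, hv0⟩ := Submodule.exists_mem_ne_zero_of_ne_bot hker
  refine ⟨fun a => if h : a ∈ A then v ⟨a, h⟩ else 0, ?_, ?_, ?_, ?_⟩
  · intro h
    refine hv0 (funext fun a => ?_)
    have := congrFun h a.1
    simpa using this
  · intro a
    dsimp only
    split_ifs
    · exact SetLike.coe_mem _
    · exact zero_mem _
  · intro a ha
    simp [ha]
  · intro z hz
    have hMv : M.mulVec v = 0 := hv
    have h := congrArg (algebraMap ℚ⟮zroot p⟯ ℂ) (congrFun hMv ⟨z, hz⟩)
    simp only [Matrix.mulVec, dotProduct, Pi.zero_apply, map_zero, map_sum, map_mul, map_pow, M,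
      AdjoinSimple.algebraMap_gen] at h
    refine Eq.trans ?_ h
    rw [zdft_apply, ← Finset.sum_subset (Finset.subset_univ A) (by simp +contextual),
      ← Finset.sum_coe_sort A]
    refine Finset.sum_congr rfl fun a _ => ?_
    simp [mul_comm]

open IntermediateField in
theorem div_mem_adjoin_zroot {p : ℕ} [Fact p.Prime] {h : ZMod p → ℂ} {A : Finset (ZMod p)}
    (hA : ∀ a ∉ A, h a = 0) (hcard : (support (zdft p h)).ncard + A.card ≤ p + 1)
    {a : ZMod p} (ha : a ∈ A) (b : ZMod p) : h b / h a ∈ ℚ⟮zroot p⟯ := by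
  classical
  by_cases hha : h a = 0
  · simp [hha, zero_mem]
  let Z : Finset (ZMod p) := (support (zdft p h)).toFinsetᶜ
  have hZ (z) (hz : z ∈ Z) : zdft p h z = 0 := by simpa [Z] using hz
  have hZcard : (A.erase a).card ≤ Z.card := by
    rw [Finset.card_compl, ZMod.card, ← Set.ncard_eq_toFinset_card', Finset.card_erase_of_mem ha]
    omega
  obtain ⟨Z', hZ', hZ'card⟩ := Finset.exists_subset_card_eq hZcard
  obtain ⟨u, hu, huK, huA, huZ⟩ := exists_ne_zero_zdft_eq_zero (A := A) (Z := Z')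
    (hZ'card ▸ Finset.card_erase_lt_of_mem ha)
  have key (w : ZMod p → ℂ) (hwA : ∀ a ∉ A, w a = 0) (hwZ : ∀ z ∈ Z', zdft p w z = 0)
      (hwa : w a = 0) : w = 0 := by
    refine eq_zero_of_zdft_eq_zero (A := A.erase a) (fun x hx => ?_) hwZ hZ'card.ge
    by_cases hxa : x = a
    · rw [hxa, hwa]
    · exact hwA x fun hxA => hx (Finset.mem_erase.mpr ⟨hxa, hxA⟩)
  have hua : u a ≠ 0 := fun h0 => hu (key u huA huZ h0)
  have hw := key (fun x => h a * u x - u a * h x) (fun x hx => by simp [huA x hx, hA x hx])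
    (fun z hz => by
      have h1 := huZ z hz
      have h2 := hZ z (hZ' hz)
      rw [zdft_apply] at h1 h2 ⊢
      simp only [sub_mul, Finset.sum_sub_distrib, mul_assoc, ← Finset.mul_sum, h1, h2]
      simp) (by ring)
  have hb : h a * u b - u a * h b = 0 := congrFun hw b
  have : h b / h a = u b / u a := by
    rw [div_eq_div_iff hha hua]
    linear_combination -hb
  rw [this]
  exact div_mem (huK b) (huK a)

open IntermediateField in
theorem IsPrimitiveRoot.notMem_adjoin_zroot {p : ℕ} [Fact p.Prime] {η : ℂ}
    (hη : IsPrimitiveRoot η (p ^ 2)) : η ∉ ℚ⟮zroot p⟯ := by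
  intro hmem
  have hp : p.Prime := Fact.out
  have hζ := isPrimitiveRoot_zroot p
  have hint : IsIntegral ℚ (zroot p) := (hζ.isIntegral hp.pos).tower_top
  have : FiniteDimensional ℚ ℚ⟮zroot p⟯ := adjoin.finiteDimensional hint
  have hmin : minpoly ℚ (⟨η, hmem⟩ : ℚ⟮zroot p⟯) = minpoly ℚ η :=
    (minpoly.algebraMap_eq (algebraMap ℚ⟮zroot p⟯ ℂ).injective _).symm
  have h1 := minpoly.natDegree_le (A := ℚ) (⟨η, hmem⟩ : ℚ⟮zroot p⟯)
  rw [adjoin.finrank hint, ← Polynomial.cyclotomic_eq_minpoly_rat hζ hp.pos,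
    Polynomial.natDegree_cyclotomic, hmin,
    ← Polynomial.cyclotomic_eq_minpoly_rat hη (pow_pos hp.pos 2),
    Polynomial.natDegree_cyclotomic, Nat.totient_prime_pow_succ hp, Nat.totient_prime hp] at h1
  have h2 := hp.two_le
  have h3 : 0 < p - 1 := by omega
  nlinarith

/-- The point of `ℤ/p²ℤ` with base-`p` digits `a` and `x`, i.e. `a + px`. -/
def cosetPoint {p : ℕ} (a x : ZMod p) : ZMod (p ^ 2) := ((a.val + p * x.val : ℕ) : ZMod (p ^ 2))

theorem val_cosetPoint {p : ℕ} [NeZero p] (a x : ZMod p) :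
    (cosetPoint a x).val = a.val + p * x.val := by
  refine ZMod.val_cast_of_lt ?_
  nlinarith [a.val_lt, x.val_lt]

theorem bijective_cosetPoint (p : ℕ) [NeZero p] :
    Bijective fun q : ZMod p × ZMod p => cosetPoint q.1 q.2 := by
  refine (Fintype.bijective_iff_injective_and_card _).mpr ⟨?_, by simp [ZMod.card, sq]⟩
  rintro ⟨a, x⟩ ⟨b, y⟩ h
  have hval := congrArg ZMod.val h
  simp only [val_cosetPoint] at hval
  have hab : a.val = b.val := by
    have := congrArg (· % p) hval
    simpa [Nat.mod_eq_of_lt a.val_lt, Nat.mod_eq_of_lt b.val_lt] using this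
  rw [hab, add_right_inj, Nat.mul_right_inj (NeZero.ne p)] at hval
  exact Prod.ext (ZMod.val_injective p hab) (ZMod.val_injective p hval)

theorem sum_cosetPoint {p : ℕ} [NeZero p] {M : Type*} [AddCommMonoid M] (F : ZMod (p ^ 2) → M) :
    ∑ z, F z = ∑ a : ZMod p, ∑ x : ZMod p, F (cosetPoint a x) := by
  rw [← (bijective_cosetPoint p).sum_comp F, Fintype.sum_prod_type]

theorem ncard_support_eq_sum_coset {p : ℕ} [NeZero p] (F : ZMod (p ^ 2) → ℂ) :
    (support F).ncard = ∑ a : ZMod p, (support fun x => F (cosetPoint a x)).ncard := by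
  rw [ncard_support_eq_sum, sum_cosetPoint]
  exact Finset.sum_congr rfl fun a _ => (ncard_support_eq_sum fun x => F (cosetPoint a x)).symm

/-- The function on the cosets of `pℤ/p²ℤ` whose Fourier transform is the restriction of `f̂` to
the coset of `y`. -/
noncomputable def cosetTwist {p : ℕ} [NeZero p] (f : ZMod (p ^ 2) → ℂ) (y a : ZMod p) : ℂ :=
  zroot (p ^ 2) ^ (a.val * y.val) * zdft p (fun x => f (cosetPoint a x)) y

theorem zdft_cosetPoint {p : ℕ} [NeZero p] (f : ZMod (p ^ 2) → ℂ) (y t : ZMod p) :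
    zdft (p ^ 2) f (cosetPoint y t) = zdft p (cosetTwist f y) t := by
  rw [zdft_apply, zdft_apply, sum_cosetPoint]
  refine Finset.sum_congr rfl fun a _ => ?_
  rw [cosetTwist, zdft_apply, Finset.mul_sum, Finset.sum_mul]
  refine Finset.sum_congr rfl fun x _ => ?_
  rw [val_cosetPoint, val_cosetPoint]
  have hexp : (a.val + p * x.val) * (y.val + p * t.val) =
      a.val * y.val + p * (x.val * y.val) + p * (a.val * t.val) + p ^ 2 * (x.val * t.val) := by ring
  rw [hexp, pow_add, pow_add, pow_add, pow_mul _ p, pow_mul _ p, pow_mul _ (p ^ 2),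
    (isPrimitiveRoot_zroot (p ^ 2)).pow_eq_one, zroot_sq_pow]
  ring

theorem ncard_support_zdft_eq_sum {p : ℕ} [NeZero p] (f : ZMod (p ^ 2) → ℂ) :
    (support (zdft (p ^ 2) f)).ncard =
      ∑ y : ZMod p, (support (zdft p (cosetTwist f y))).ncard := by
  rw [ncard_support_eq_sum_coset]
  simp only [zdft_cosetPoint]

theorem cosetTwist_eq_zero {p : ℕ} [NeZero p] {f : ZMod (p ^ 2) → ℂ} {a : ZMod p}
    (h : ∀ x, f (cosetPoint a x) = 0) (y : ZMod p) : cosetTwist f y a = 0 := by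
  simp [cosetTwist, zdft_apply, h]

theorem zroot_ne_zero (n : ℕ) : zroot n ≠ 0 := Complex.exp_ne_zero _

theorem cosetTwist_ne_zero_iff {p : ℕ} [NeZero p] {f : ZMod (p ^ 2) → ℂ} {y a : ZMod p} :
    cosetTwist f y a ≠ 0 ↔ zdft p (fun x => f (cosetPoint a x)) y ≠ 0 := by
  simp [cosetTwist, zroot_ne_zero]

theorem ncard_support_zdft_of_coset {p : ℕ} [NeZero p] {f : ZMod (p ^ 2) → ℂ} {a : ZMod p}
    (h : ∀ b, b ≠ a → ∀ x, f (cosetPoint b x) = 0) :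
    (support (zdft (p ^ 2) f)).ncard =
      p * (support (zdft p fun x => f (cosetPoint a x))).ncard := by
  rw [ncard_support_zdft_eq_sum, ncard_support_eq_sum (zdft p fun x => f (cosetPoint a x)),
    Finset.mul_sum]
  refine Finset.sum_congr rfl fun y _ => ?_
  have hz := zdft_eq_of_eq_zero (g := cosetTwist f y) fun b hb => cosetTwist_eq_zero (h b hb) y
  by_cases h0 : zdft p (fun x => f (cosetPoint a x)) y = 0
  · have : zdft p (cosetTwist f y) = 0 := by
      ext t
      rw [hz, not_not.mp (mt cosetTwist_ne_zero_iff.mp (not_not.mpr h0))]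
      simp
    simp [this, h0]
  · have : support (zdft p (cosetTwist f y)) = Set.univ := by
      ext t
      simp [hz, cosetTwist_ne_zero_iff.mpr h0, zroot_ne_zero]
    simp [this, h0, Set.ncard_univ]

theorem ztheta_sq_le {p : ℕ} [Fact p.Prime] {k : ℕ} (hk1 : 1 ≤ k) (hk2 : k ≤ p) :
    ztheta (p ^ 2) k ≤ p * (p - k + 1) := by
  classical
  obtain ⟨A, hA⟩ : ∃ A : Finset (ZMod p), A.card = k := by
    obtain ⟨A, -, hA⟩ := Finset.exists_subset_card_eq (s := (Finset.univ : Finset (ZMod p)))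
      (n := k) (by simpa [ZMod.card] using hk2)
    exact ⟨A, hA⟩
  obtain ⟨Z, -, hZ⟩ := Finset.exists_subset_card_eq (s := A) (n := k - 1) (by omega)
  obtain ⟨u, hu, -, huA, huZ⟩ := exists_ne_zero_zdft_eq_zero (A := A) (Z := Z) (by omega)
  let e := Equiv.ofBijective _ (bijective_cosetPoint p)
  let f : ZMod (p ^ 2) → ℂ := fun z => if (e.symm z).1 = 0 then u (e.symm z).2 else 0
  have he (a x : ZMod p) : e.symm (cosetPoint a x) = (a, x) := e.symm_apply_apply (a, x)
  have hf0 : (fun x => f (cosetPoint 0 x)) = u := by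
    ext x
    simp [f, he]
  have hf (b : ZMod p) (hb : b ≠ 0) (x : ZMod p) : f (cosetPoint b x) = 0 := by
    simp [f, he, hb]
  have hle : ztheta (p ^ 2) k ≤ (support (zdft (p ^ 2) f)).ncard := by
    refine Nat.sInf_le ⟨f, ?_, ?_, rfl⟩
    · intro h
      rw [h] at hf0
      exact hu hf0.symm
    · rw [ncard_support_eq_sum_coset, Fintype.sum_eq_single 0 (fun b hb => by simp [hf b hb]), hf0,
        Set.ncard_eq_toFinset_card', ← hA]
      refine Finset.card_le_card fun a ha => ?_
      by_contra haA
      simp [huA a haA] at ha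
  refine hle.trans ?_
  rw [ncard_support_zdft_of_coset hf, hf0, Set.ncard_eq_toFinset_card']
  refine Nat.mul_le_mul_left p ?_
  have hsub : (support (zdft p u)).toFinset ⊆ Zᶜ := fun z hz => by
    rw [Finset.mem_compl]
    intro hzZ
    simp [huZ z hzZ] at hz
  have := Finset.card_le_card hsub
  rw [Finset.card_compl, ZMod.card] at this
  omega

/-- A function meeting each coset of `pℤ/p²ℤ` in at most one point, and at least two cosets, has
some coset of frequencies on which its Fourier transform has more than the minimal support. -/
theorem exists_lt_ncard_support_zdft_cosetTwist {p : ℕ} [Fact p.Prime] {f : ZMod (p ^ 2) → ℂ}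
    {A : Finset (ZMod p)} (hA : ∀ a ∉ A, ∀ x, f (cosetPoint a x) = 0)
    (hA1 : ∀ a ∈ A, (support fun x => f (cosetPoint a x)).ncard = 1) (hcard : 2 ≤ A.card) :
    ∃ y : ZMod p, p + 1 < (support (zdft p (cosetTwist f y))).ncard + A.card := by
  classical
  by_contra! hall
  have hp : p.Prime := Fact.out
  have hω := isPrimitiveRoot_zroot (p ^ 2)
  have hω0 := zroot_ne_zero (p ^ 2)
  obtain ⟨a, ha, b, hb, hab⟩ := Finset.one_lt_card.mp hcard
  have htwist (c : ZMod p) (hc : c ∈ A) : ∃ x : ZMod p, f (cosetPoint c x) ≠ 0 ∧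
      ∀ y, cosetTwist f y c =
        f (cosetPoint c x) * zroot (p ^ 2) ^ ((c.val + p * x.val) * y.val) := by
    obtain ⟨x, hx⟩ := Set.ncard_eq_one.mp (hA1 c hc)
    refine ⟨x, (hx.symm ▸ Set.mem_singleton x : x ∈ support fun x => f (cosetPoint c x)),
      fun y => ?_⟩
    rw [cosetTwist, zdft_eq_of_eq_zero (a := x) fun t ht => ?_]
    · rw [← zroot_sq_pow p, add_mul, pow_add, mul_assoc, pow_mul _ p]
      ring
    · by_contra h0
      exact ht (hx.subset h0)
  have hratio (y : ZMod p) := div_mem_adjoin_zroot (h := cosetTwist f y) (A := A)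
    (fun c hc => cosetTwist_eq_zero (hA c hc) y) (hall y) ha b
  obtain ⟨s, hs, hsy⟩ := htwist a ha
  obtain ⟨t, ht, hty⟩ := htwist b hb
  have h0 := hratio 0
  have h1 := hratio 1
  rw [hsy, hty] at h0 h1
  simp only [ZMod.val_zero, ZMod.val_one, mul_zero, pow_zero, mul_one] at h0 h1
  have hmem := div_mem h1 h0
  have hη : f (cosetPoint b t) * zroot (p ^ 2) ^ (b.val + p * t.val) /
      (f (cosetPoint a s) * zroot (p ^ 2) ^ (a.val + p * s.val)) /
      (f (cosetPoint b t) / f (cosetPoint a s)) =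
      zroot (p ^ 2) ^ (((b.val + p * t.val : ℕ) : ℤ) - ((a.val + p * s.val : ℕ) : ℤ)) := by
    rw [zpow_sub₀ hω0, zpow_natCast, zpow_natCast]
    field_simp
  rw [hη] at hmem
  refine IsPrimitiveRoot.notMem_adjoin_zroot (hω.zpow_of_gcd_eq_one _ ?_) hmem
  rw [← Int.isCoprime_iff_gcd_eq_one]
  push_cast
  refine IsCoprime.pow_right ((Nat.prime_iff_prime_int.mp hp).coprime_iff_not_dvd.mpr ?_).symm
  intro hdvd
  rw [← ZMod.intCast_zmod_eq_zero_iff_dvd] at hdvd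
  push_cast at hdvd
  simp only [ZMod.natCast_val, ZMod.cast_id', id_eq, CharP.cast_eq_zero, zero_mul, add_zero] at hdvd
  exact hab (sub_eq_zero.mp hdvd).symm

/-- A function on `ℤ/p²ℤ` with `k ≤ p` points in its support and at most `p(p - k + 1)` in its
spectrum is supported on a single coset of `pℤ/p²ℤ`. -/
theorem exists_forall_cosetPoint_eq_zero {p : ℕ} [Fact p.Prime] {k : ℕ} (hk : k ≤ p)
    {f : ZMod (p ^ 2) → ℂ} (hf : f ≠ 0) (hfk : (support f).ncard = k)
    (hspec : (support (zdft (p ^ 2) f)).ncard ≤ p * (p - k + 1)) :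
    ∃ a : ZMod p, ∀ b, b ≠ a → ∀ x, f (cosetPoint b x) = 0 := by
  classical
  let g (a x : ZMod p) : ℂ := f (cosetPoint a x)
  let A : Finset (ZMod p) := {a | g a ≠ 0}
  have hA (a) (ha : a ∉ A) (x) : f (cosetPoint a x) = 0 := by
    have : g a = 0 := by simpa [A] using ha
    exact congrFun this x
  have hpos (a) (ha : a ∈ A) : 1 ≤ (support (g a)).ncard := by
    rw [Nat.one_le_iff_ne_zero, Ne, Set.ncard_eq_zero (Set.toFinite _), support_eq_empty_iff]
    simpa [A] using ha
  have hsum : ∑ a ∈ A, (support (g a)).ncard = k := by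
    rw [← hfk, ncard_support_eq_sum_coset]
    exact Finset.sum_subset (Finset.subset_univ A) fun a _ ha => by simp [g, hA a ha]
  obtain ⟨a, ha⟩ : A.Nonempty := by
    by_contra! h
    refine hf (funext fun z => ?_)
    obtain ⟨⟨a, x⟩, rfl⟩ := (bijective_cosetPoint p).surjective z
    exact hA a (by simp [h]) x
  refine ⟨a, fun b hb => hA b fun hbA => ?_⟩
  have hA2 : 2 ≤ A.card := Finset.one_lt_card.mpr ⟨b, hbA, a, ha, hb⟩
  have hAk : A.card ≤ k := by
    rw [← hsum, Finset.card_eq_sum_ones]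
    exact Finset.sum_le_sum hpos
  have htwist (y) (hy : cosetTwist f y ≠ 0) :
      p + 1 ≤ A.card + (support (zdft p (cosetTwist f y))).ncard := by
    refine (add_one_le_ncard_support_add hy).trans (Nat.add_le_add_right ?_ _)
    rw [Set.ncard_eq_toFinset_card']
    refine Finset.card_le_card fun c hc => ?_
    by_contra hcA
    simp [cosetTwist_eq_zero (hA c hcA) y] at hc
  have htwist_ne (y c) (hy : zdft p (g c) y ≠ 0) : cosetTwist f y ≠ 0 := fun h =>
    cosetTwist_ne_zero_iff.mpr hy (congrFun h c)
  have huncert (c) (hc : c ∈ A) := add_one_le_ncard_support_add (g := g c) (by simpa [A] using hc)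
  rw [ncard_support_zdft_eq_sum] at hspec
  rcases hAk.lt_or_eq with hlt | heq
  · have hga : (support (g a)).ncard + (A.card - 1) ≤ k := by
      rw [← hsum, ← Finset.add_sum_erase A _ ha, ← Finset.card_erase_of_mem ha,
        Finset.card_eq_sum_ones]
      exact Nat.add_le_add_left
        (Finset.sum_le_sum fun c hc => hpos c (Finset.mem_of_mem_erase hc)) _
    have hlow : (support (zdft p (g a))).ncard * (p + 1 - A.card) ≤
        ∑ y, (support (zdft p (cosetTwist f y))).ncard := by
      rw [ncard_support_eq_sum, Finset.sum_mul]
      refine Finset.sum_le_sum fun y _ => ?_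
      by_cases hy : zdft p (g a) y = 0
      · simp [hy]
      · have := htwist y (htwist_ne y a hy)
        simp only [Set.indicator_of_mem (mem_support.mpr hy), Pi.one_apply, one_mul]
        omega
    have hu := huncert a ha
    have hprod : (p - k + A.card) * (p + 1 - A.card) ≤ p * (p - k + 1) :=
      (Nat.mul_le_mul_right _ (by omega)).trans (hlow.trans hspec)
    obtain ⟨t, ht⟩ := Nat.exists_eq_add_of_le hA2
    obtain ⟨r, hr⟩ := Nat.exists_eq_add_of_lt hlt
    obtain ⟨q, hq⟩ := Nat.exists_eq_add_of_le hk
    rw [show p - k + A.card = q + t + 2 by omega, show p + 1 - A.card = q + r + 2 by omega,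
      show p - k + 1 = q + 1 by omega, show p = q + t + r + 3 by omega] at hprod
    nlinarith
  · have hone (c) (hc : c ∈ A) : (support (g c)).ncard = 1 := by
      have h1 : ∑ c ∈ A, 1 = ∑ c ∈ A, (support (g c)).ncard := by
        rw [hsum, ← heq, Finset.card_eq_sum_ones]
      exact ((Finset.sum_eq_sum_iff_of_le hpos).mp h1 c hc).symm
    have hne (y) : cosetTwist f y ≠ 0 := by
      refine htwist_ne y a fun hy => ?_
      have hu := huncert a ha
      rw [hone a ha] at hu
      have hlt : (support (zdft p (g a))).ncard < p := by
        have h := Set.ncard_lt_card (s := support (zdft p (g a)))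
          fun h => (h ▸ Set.mem_univ y : y ∈ support (zdft p (g a))) hy
        simpa [ZMod.card] using h
      omega
    obtain ⟨y, hy⟩ := exists_lt_ncard_support_zdft_cosetTwist hA hone hA2
    have hlt : ∑ _y : ZMod p, (p - k + 1) < ∑ y, (support (zdft p (cosetTwist f y))).ncard := by
      refine Finset.sum_lt_sum (fun z _ => ?_) ⟨y, Finset.mem_univ y, ?_⟩
      · have := htwist z (hne z)
        omega
      · omega
    rw [Finset.sum_const, Finset.card_univ, ZMod.card, smul_eq_mul] at hlt
    omega

/-- For `G = ℤ/p²ℤ`, `p` prime, `H = pℤ/p²ℤ` and `1 ≤ k ≤ p`, every equality case for `(k, G)`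
satisfies `f(a + px) = g(x)` for `x = 0, …, p-1` and vanishes outside the coset `a + H`,
where `a ∈ {0, …, p-1}` and `g : ℤ/pℤ → ℂ` has `|supp g| = k` and `|supp ĝ| = p - k + 1`. -/
theorem equality_case_p_squared_small (p : ℕ) [Fact p.Prime]
    (k : ℕ) (hk1 : 1 ≤ k) (hk2 : k ≤ p)
    (f : ZMod (p ^ 2) → ℂ) (hf : IsZEqualityCase (p ^ 2) k f) :
    ∃ a : ℕ, a < p ∧ ∃ g : ZMod p → ℂ,
      (support g).ncard = k ∧ (support (zdft p g)).ncard = p - k + 1 ∧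
      (∀ x : ℕ, x < p →
        f ((a : ZMod (p ^ 2)) + (p : ZMod (p ^ 2)) * (x : ZMod (p ^ 2))) = g (x : ZMod p)) ∧
      (∀ z : ZMod (p ^ 2),
        (∀ c : ZMod (p ^ 2), z ≠ (a : ZMod (p ^ 2)) + (p : ZMod (p ^ 2)) * c) → f z = 0) := by
  obtain ⟨hf0, hfk, hspec⟩ := hf
  have hle := hspec.trans_le (ztheta_sq_le hk1 hk2)
  obtain ⟨a, ha⟩ := exists_forall_cosetPoint_eq_zero hk2 hf0 hfk hle
  have hgk : (support fun x => f (cosetPoint a x)).ncard = k := by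
    rw [← hfk, ncard_support_eq_sum_coset]
    refine (Fintype.sum_eq_single (f := fun b => (support fun x => f (cosetPoint b x)).ncard) a
      fun b hb => ?_).symm
    simp [ha b hb]
  refine ⟨a.val, a.val_lt, fun x => f (cosetPoint a x), hgk, ?_, fun x hx => ?_, fun z hz => ?_⟩
  · rw [ncard_support_zdft_of_coset ha] at hle
    have hle' := Nat.le_of_mul_le_mul_left hle (Fact.out : p.Prime).pos
    have hg : (fun x => f (cosetPoint a x)) ≠ 0 := by
      intro h
      rw [h] at hgk
      simp at hgk
      omega
    have := add_one_le_ncard_support_add hg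
    omega
  · simp only [cosetPoint]
    rw [ZMod.val_cast_of_lt hx]
    push_cast
    rfl
  · obtain ⟨⟨b, x⟩, rfl⟩ := (bijective_cosetPoint p).surjective z
    refine ha b (fun hb => hz (x.val : ZMod (p ^ 2)) ?_) x
    simp only [hb, cosetPoint]
    push_cast
    rfl
end
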